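/- arXiv:2512.11235 — 2 statements merged into one kernel-verified Lean document; each statement's English description precedes it below -/
import Mathlib

section
/- If K is a finite tree (a connected acyclic simple graph) with edge set E, then the representation variety R(K, SO(3)) has exactly 2^{|E|} connected components. -/
noncomputable section

/-- `SO(3)`: the space of real `3 × 3` matrices `A` with `A * Aᵀ = 1` and `det A = 1`,
topologized as a subspace of the space of matrices. -/
abbrev SO3 : Type := {A : Matrix (Fin 3) (Fin 3) ℝ // A * A.transpose = 1 ∧ A.det = 1}

/-- The representation variety `R(K, SO(3))`: the subspace of `SO(3)^V` of tuples whose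
entries commute along the edges of `K`. -/
def RepVar {V : Type*} (K : SimpleGraph V) : Set (V → SO3) :=
  {x | ∀ v w : V, K.Adj v w → (x v).1 * (x w).1 = (x w).1 * (x v).1}

open scoped Quaternion

/-- The matrix of `v ↦ q * v * star q` on the imaginary quaternions. -/
def quatMatrix (q : ℍ[ℝ]) : Matrix (Fin 3) (Fin 3) ℝ :=
  !![q.re ^ 2 + q.imI ^ 2 - q.imJ ^ 2 - q.imK ^ 2, 2 * (q.imI * q.imJ - q.re * q.imK),
      2 * (q.imI * q.imK + q.re * q.imJ);
    2 * (q.imI * q.imJ + q.re * q.imK), q.re ^ 2 - q.imI ^ 2 + q.imJ ^ 2 - q.imK ^ 2,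
      2 * (q.imJ * q.imK - q.re * q.imI);
    2 * (q.imI * q.imK - q.re * q.imJ), 2 * (q.imJ * q.imK + q.re * q.imI),
      q.re ^ 2 - q.imI ^ 2 - q.imJ ^ 2 + q.imK ^ 2]

theorem quatMatrix_mul (p q : ℍ[ℝ]) : quatMatrix (p * q) = quatMatrix p * quatMatrix q := by
  ext i j
  fin_cases i <;> fin_cases j <;>
    simp [quatMatrix, Matrix.mul_apply, Fin.sum_univ_three] <;> ring

theorem quatMatrix_mul_transpose (q : ℍ[ℝ]) :
    quatMatrix q * (quatMatrix q).transpose = (Quaternion.normSq q) ^ 2 • 1 := by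
  ext i j
  fin_cases i <;> fin_cases j <;>
    simp [quatMatrix, Matrix.mul_apply, Fin.sum_univ_three, Quaternion.normSq_def'] <;> ring

theorem det_quatMatrix (q : ℍ[ℝ]) : (quatMatrix q).det = (Quaternion.normSq q) ^ 3 := by
  simp [quatMatrix, Matrix.det_fin_three, Quaternion.normSq_def']
  ring

theorem continuous_quatMatrix : Continuous quatMatrix := by
  have h0 := Quaternion.continuous_re
  have h1 := Quaternion.continuous_imI
  have h2 := Quaternion.continuous_imJ
  have h3 := Quaternion.continuous_imK
  refine continuous_matrix fun i j => ?_
  fin_cases i <;> fin_cases j <;> simp [quatMatrix] <;> fun_prop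

/-- The nonzero quaternions, as a subspace of `ℍ`. -/
abbrev NonzeroQuat : Type := {q : ℍ[ℝ] // q ≠ 0}

theorem NonzeroQuat.normSq_ne_zero (q : NonzeroQuat) : Quaternion.normSq q.1 ≠ 0 :=
  fun h => q.2 (Quaternion.normSq_eq_zero.1 h)

/-- The rotation `v ↦ q * v * q⁻¹` of the imaginary quaternions. -/
def toSO3 (q : NonzeroQuat) : SO3 :=
  ⟨(Quaternion.normSq q.1)⁻¹ • quatMatrix q.1, by
    have h := NonzeroQuat.normSq_ne_zero q
    constructor
    · rw [Matrix.transpose_smul, Matrix.smul_mul, Matrix.mul_smul, quatMatrix_mul_transpose,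
        smul_smul, smul_smul]
      field_simp
      simp
    · rw [Matrix.det_smul, det_quatMatrix, Fintype.card_fin]
      field_simp⟩

theorem continuous_toSO3 : Continuous toSO3 := by
  have h : Continuous fun q : NonzeroQuat => (Quaternion.normSq q.1)⁻¹ :=
    (Quaternion.continuous_normSq.comp continuous_subtype_val).inv₀ NonzeroQuat.normSq_ne_zero
  exact (h.smul (continuous_quatMatrix.comp continuous_subtype_val)).subtype_mk _

/-- The products `qᵢ * qⱼ` of the coordinates of a quaternion determine its rotation. -/
theorem quatMatrix_eq_normSq_smul {A : Matrix (Fin 3) (Fin 3) ℝ} {q : ℍ[ℝ]} (m : ℝ)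
    (haa : q.re * q.re = m * (1 + A 0 0 + A 1 1 + A 2 2))
    (hbb : q.imI * q.imI = m * (1 + A 0 0 - A 1 1 - A 2 2))
    (hcc : q.imJ * q.imJ = m * (1 - A 0 0 + A 1 1 - A 2 2))
    (hdd : q.imK * q.imK = m * (1 - A 0 0 - A 1 1 + A 2 2))
    (hab : q.re * q.imI = m * (A 2 1 - A 1 2)) (hac : q.re * q.imJ = m * (A 0 2 - A 2 0))
    (had : q.re * q.imK = m * (A 1 0 - A 0 1)) (hbc : q.imI * q.imJ = m * (A 0 1 + A 1 0))
    (hbd : q.imI * q.imK = m * (A 0 2 + A 2 0)) (hcd : q.imJ * q.imK = m * (A 1 2 + A 2 1)) :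
    quatMatrix q = Quaternion.normSq q • A := by
  have hn : Quaternion.normSq q = m * 4 := by
    rw [Quaternion.normSq_def']
    linarith
  ext i j
  rw [hn]
  fin_cases i <;> fin_cases j <;> simp [quatMatrix] <;> linarith

theorem exists_quatMatrix_eq (A : Matrix (Fin 3) (Fin 3) ℝ) (hA : A * A.transpose = 1)
    (hdet : A.det = 1) :
    ∃ q : ℍ[ℝ], q ≠ 0 ∧ quatMatrix q = Quaternion.normSq q • A := by
  have hA' : A.transpose * A = 1 := mul_eq_one_comm.1 hA
  have hadj : A.adjugate = A.transpose := by
    calc A.adjugate = A.adjugate * (A * A.transpose) := by rw [hA, mul_one]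
      _ = A.transpose := by rw [← mul_assoc, Matrix.adjugate_mul, hdet, one_smul, one_mul]
  have r (i j : Fin 3) := congrFun (congrFun hA i) j
  have c (i j : Fin 3) := congrFun (congrFun hA' i) j
  have d (i j : Fin 3) := congrFun (congrFun hadj i) j
  simp only [Fin.forall_fin_succ, Matrix.mul_apply, Fin.sum_univ_three, Matrix.transpose_apply,
    Matrix.adjugate_fin_three, Matrix.one_apply, Matrix.of_apply] at r c d
  simp at r c d
  obtain ⟨⟨r1, r2, r3⟩, ⟨r4, r5, r6⟩, r7, r8, r9⟩ := r
  obtain ⟨⟨c1, c2, c3⟩, ⟨c4, c5, c6⟩, c7, c8, c9⟩ := c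
  obtain ⟨⟨d1, d2, d3⟩, ⟨d4, d5, d6⟩, d7, d8, d9⟩ := d
  by_cases h0 : 1 + A 0 0 + A 1 1 + A 2 2 ≠ 0
  · refine ⟨⟨1 + A 0 0 + A 1 1 + A 2 2, A 2 1 - A 1 2,
        A 0 2 - A 2 0, A 1 0 - A 0 1⟩,
      fun h => h0 (congrArg QuaternionAlgebra.re h),
      quatMatrix_eq_normSq_smul (1 + A 0 0 + A 1 1 + A 2 2) ?_ ?_ ?_ ?_ ?_ ?_ ?_ ?_ ?_ ?_⟩ <;>
    dsimp only <;> linarith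
  by_cases h1 : 1 + A 0 0 - A 1 1 - A 2 2 ≠ 0
  · refine ⟨⟨A 2 1 - A 1 2, 1 + A 0 0 - A 1 1 - A 2 2,
        A 0 1 + A 1 0, A 0 2 + A 2 0⟩,
      fun h => h1 (congrArg QuaternionAlgebra.imI h),
      quatMatrix_eq_normSq_smul (1 + A 0 0 - A 1 1 - A 2 2) ?_ ?_ ?_ ?_ ?_ ?_ ?_ ?_ ?_ ?_⟩ <;>
    dsimp only <;> linarith
  by_cases h2 : 1 - A 0 0 + A 1 1 - A 2 2 ≠ 0
  · refine ⟨⟨A 0 2 - A 2 0, A 0 1 + A 1 0,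
        1 - A 0 0 + A 1 1 - A 2 2, A 1 2 + A 2 1⟩,
      fun h => h2 (congrArg QuaternionAlgebra.imJ h),
      quatMatrix_eq_normSq_smul (1 - A 0 0 + A 1 1 - A 2 2) ?_ ?_ ?_ ?_ ?_ ?_ ?_ ?_ ?_ ?_⟩ <;>
    dsimp only <;> linarith
  rw [not_ne_iff] at h0 h1 h2
  refine ⟨⟨A 1 0 - A 0 1, A 0 2 + A 2 0,
      A 1 2 + A 2 1, 1 - A 0 0 - A 1 1 + A 2 2⟩,
    fun h => ?_, quatMatrix_eq_normSq_smul (1 - A 0 0 - A 1 1 + A 2 2) ?_ ?_ ?_ ?_ ?_ ?_ ?_ ?_ ?_ ?_⟩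
  · have h3 := congrArg QuaternionAlgebra.imK h
    simp only [Quaternion.imK_zero] at h3
    linarith
  all_goals linarith

theorem toSO3_surjective : Function.Surjective toSO3 := by
  rintro ⟨A, hA, hdet⟩
  obtain ⟨q, hq, h⟩ := exists_quatMatrix_eq A hA hdet
  refine ⟨⟨q, hq⟩, Subtype.ext ?_⟩
  change (Quaternion.normSq q)⁻¹ • quatMatrix q = A
  rw [h, smul_smul, inv_mul_cancel₀ (Quaternion.normSq_ne_zero.2 hq), one_smul]

/-- The matrix of a quaternion determines it up to real scalars. -/
theorem eq_smul_of_smul_quatMatrix_eq {p q : ℍ[ℝ]} (hp : p ≠ 0)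
    (h : Quaternion.normSq q • quatMatrix p = Quaternion.normSq p • quatMatrix q) :
    ∃ c : ℝ, q = c • p := by
  have e (i j : Fin 3) := congrFun (congrFun h i) j
  simp only [Fin.forall_fin_succ, quatMatrix, Matrix.smul_apply] at e
  simp at e
  obtain ⟨⟨e1, e2, e3⟩, ⟨e4, e5, e6⟩, e7, e8, e9⟩ := e
  have hp' := Quaternion.normSq_ne_zero.2 hp
  obtain ⟨n, hn⟩ : ∃ n, n = Quaternion.normSq p := ⟨_, rfl⟩
  obtain ⟨m, hm⟩ : ∃ m, m = Quaternion.normSq q := ⟨_, rfl⟩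
  rw [← hn, ← hm] at e1 e2 e3 e4 e5 e6 e7 e8 e9
  rw [← hn] at hp'
  rw [Quaternion.normSq_def'] at hn hm
  refine ⟨(p.re * q.re + p.imI * q.imI + p.imJ * q.imJ + p.imK * q.imK) / n,
    sub_eq_zero.1 (Quaternion.normSq_eq_zero.1 ?_)⟩
  rw [Quaternion.normSq_def']
  simp only [Quaternion.re_sub, Quaternion.imI_sub, Quaternion.imJ_sub, Quaternion.imK_sub,
    Quaternion.re_smul, Quaternion.imI_smul, Quaternion.imJ_smul, Quaternion.imK_smul, smul_eq_mul]
  clear h hp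
  generalize p.re = a, p.imI = b, p.imJ = c, p.imK = d, q.re = x, q.imI = y, q.imJ = z,
    q.imK = w at *
  have hs : (a * x + b * y + c * z + d * w) ^ 2 = n * m := by
    have f0 : m * a ^ 2 = n * x ^ 2 := by
      linear_combination (e1 + e5 + e9 + n * hm - m * hn) / 4
    have f1 : m * b ^ 2 = n * y ^ 2 := by
      linear_combination (e1 - e5 - e9 + n * hm - m * hn) / 4
    have f2 : m * c ^ 2 = n * z ^ 2 := by
      linear_combination (- e1 + e5 - e9 + n * hm - m * hn) / 4
    have f3 : m * d ^ 2 = n * w ^ 2 := by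
      linear_combination (- e1 - e5 + e9 + n * hm - m * hn) / 4
    have f4 : m * (a * b) = n * (x * y) := by linarith
    have f5 : m * (a * c) = n * (x * z) := by linarith
    have f6 : m * (a * d) = n * (x * w) := by linarith
    have f7 : m * (b * c) = n * (y * z) := by linarith
    have f8 : m * (b * d) = n * (y * w) := by linarith
    have f9 : m * (c * d) = n * (z * w) := by linarith
    refine mul_left_cancel₀ hp' ?_
    have : n * (a * x + b * y + c * z + d * w) ^ 2 = m * n ^ 2 := by
      calc n * (a * x + b * y + c * z + d * w) ^ 2
          = a ^ 2 * (n * x ^ 2) + b ^ 2 * (n * y ^ 2) + c ^ 2 * (n * z ^ 2) + d ^ 2 * (n * w ^ 2)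
            + 2 * (a * b) * (n * (x * y)) + 2 * (a * c) * (n * (x * z))
            + 2 * (a * d) * (n * (x * w)) + 2 * (b * c) * (n * (y * z))
            + 2 * (b * d) * (n * (y * w)) + 2 * (c * d) * (n * (z * w)) := by ring
        _ = m * n ^ 2 := by
          rw [← f0, ← f1, ← f2, ← f3, ← f4, ← f5, ← f6, ← f7, ← f8, ← f9, hn]
          ring
    rw [this]
    ring
  generalize hs' : a * x + b * y + c * z + d * w = s at *
  field_simp
  linear_combination -n ^ 2 * hm - s ^ 2 * hn - 2 * n * s * hs' - n * hs

theorem toSO3_eq_iff {p q : NonzeroQuat} : toSO3 p = toSO3 q ↔ ∃ c : ℝ, q.1 = c • p.1 := by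
  have hp := NonzeroQuat.normSq_ne_zero p
  have hq := NonzeroQuat.normSq_ne_zero q
  constructor
  · intro h
    refine eq_smul_of_smul_quatMatrix_eq p.2 ?_
    have h' : (Quaternion.normSq p.1)⁻¹ • quatMatrix p.1 =
      (Quaternion.normSq q.1)⁻¹ • quatMatrix q.1 := congrArg Subtype.val h
    rw [inv_smul_eq_iff₀ hp] at h'
    rw [h', smul_smul, smul_smul]
    congr 1
    field_simp
  · rintro ⟨c, hc⟩
    have hc0 : c ≠ 0 := by
      rintro rfl
      exact q.2 (by rw [hc, zero_smul])
    have hM : quatMatrix (c • p.1) = c ^ 2 • quatMatrix p.1 := by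
      ext i j
      fin_cases i <;> fin_cases j <;> simp [quatMatrix] <;> ring
    refine Subtype.ext ?_
    simp only [toSO3]
    rw [hc, hM, Quaternion.normSq_smul, smul_smul]
    congr 1
    field_simp

theorem toSO3_commute_iff (p q : NonzeroQuat) :
    (toSO3 p).1 * (toSO3 q).1 = (toSO3 q).1 * (toSO3 p).1 ↔
      p.1 * q.1 = q.1 * p.1 ∨ p.1 * q.1 = -(q.1 * p.1) := by
  have key (p q : NonzeroQuat) :
      (toSO3 p).1 * (toSO3 q).1 = (toSO3 ⟨p.1 * q.1, mul_ne_zero p.2 q.2⟩).1 := by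
    simp only [toSO3, map_mul, quatMatrix_mul, Matrix.smul_mul, Matrix.mul_smul, smul_smul]
    congr 1
    field_simp
  rw [key, key, ← Subtype.ext_iff, toSO3_eq_iff]
  constructor
  · rintro ⟨c, hc⟩
    have h := congrArg Quaternion.normSq hc
    simp only [map_mul, Quaternion.normSq_smul] at h
    have hp := NonzeroQuat.normSq_ne_zero p
    have hq := NonzeroQuat.normSq_ne_zero q
    have hc1 : c ^ 2 = 1 :=
      mul_right_cancel₀ (mul_ne_zero hp hq) (by linear_combination -h)
    rcases sq_eq_one_iff.1 hc1 with rfl | rfl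
    · left
      simpa using hc.symm
    · right
      change q.1 * p.1 = (-1 : ℝ) • (p.1 * q.1) at hc
      simp [hc]
  · rintro (h | h)
    · exact ⟨1, by simp [h]⟩
    · exact ⟨-1, by simp [h]⟩

theorem re_eq_zero_of_anticommute {p q : ℍ[ℝ]} (hq : q ≠ 0) (h : p * q = -(q * p)) :
    p.re = 0 := by
  have h0 := congrArg QuaternionAlgebra.re h
  have h1 := congrArg QuaternionAlgebra.imI h
  have h2 := congrArg QuaternionAlgebra.imJ h
  have h3 := congrArg QuaternionAlgebra.imK h
  simp at h0 h1 h2 h3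
  refine (mul_eq_zero.1 ?_).resolve_right (Quaternion.normSq_ne_zero.2 hq)
  rw [Quaternion.normSq_def']
  linear_combination (q.re * h0 + q.imI * h1 + q.imJ * h2 + q.imK * h3) / 2

theorem mul_self_of_re_eq_zero {q : ℍ[ℝ]} (h : q.re = 0) : q * q = -(‖q‖ * ‖q‖) • 1 := by
  rw [← Quaternion.normSq_eq_norm_mul_self]
  ext <;> simp [Quaternion.normSq_def', h] <;> ring

/-- Two nonzero imaginary quaternions are conjugate up to a real scalar, by an element which lies
in the algebra generated by their product and can be joined to `1` by a segment avoiding `0`. -/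
theorem exists_conj_eq {a b : ℍ[ℝ]} (ha : a.re = 0) (hb : b.re = 0) (hb0 : b ≠ 0) :
    ∃ c : ℍ[ℝ], (∃ r : ℝ, c * a = r • (b * c)) ∧ (∀ x, Commute x (b * a) → Commute x c) ∧
      ∀ t : ℝ, (1 - t) • 1 + t • c ≠ 0 := by
  have hbn : ‖b‖ ≠ 0 := norm_ne_zero_iff.2 hb0
  by_cases hr : ∃ r : ℝ, a = r • b
  · obtain ⟨r, rfl⟩ := hr
    refine ⟨1, ⟨r, by simp⟩, fun x _ => Commute.one_right x, fun t => ?_⟩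
    rw [← add_smul]
    simp
  · refine ⟨b * a - (‖a‖ * ‖b‖) • 1, ⟨‖a‖ / ‖b‖, ?_⟩, fun x hx =>
      hx.sub_right ((Commute.one_right x).smul_right _), fun t ht => hr ?_⟩
    · have h1 : (b * a - (‖a‖ * ‖b‖) • 1) * a = -(‖a‖ * ‖a‖) • b - (‖a‖ * ‖b‖) • a := by
        rw [sub_mul, mul_assoc, mul_self_of_re_eq_zero ha]
        simp
      have h2 : b * (b * a - (‖a‖ * ‖b‖) • 1) = -(‖b‖ * ‖b‖) • a - (‖a‖ * ‖b‖) • b := by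
        rw [mul_sub, ← mul_assoc, mul_self_of_re_eq_zero hb]
        simp
      rw [h1, h2, smul_sub, smul_smul, smul_smul]
      have e1 : ‖a‖ / ‖b‖ * -(‖b‖ * ‖b‖) = -(‖a‖ * ‖b‖) := by field_simp
      have e2 : ‖a‖ / ‖b‖ * (‖a‖ * ‖b‖) = ‖a‖ * ‖a‖ := by field_simp
      rw [e1, e2]
      module
    · have ht0 : t ≠ 0 := by
        rintro rfl
        simp at ht
      obtain ⟨s, hs⟩ : ∃ s : ℝ, b * a = s • 1 := by
        refine ⟨‖a‖ * ‖b‖ - (1 - t) / t, ?_⟩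
        have h := congrArg (t⁻¹ • ·) ht
        simp only [smul_add, smul_smul, inv_mul_cancel₀ ht0, smul_zero, one_smul] at h
        rw [div_eq_inv_mul, sub_smul, ← sub_eq_zero, ← h]
        abel
      have h := congrArg (b * ·) hs
      simp only [← mul_assoc, mul_self_of_re_eq_zero hb, mul_smul_comm, mul_one, smul_mul_assoc,
        one_mul] at h
      refine ⟨-(‖b‖ * ‖b‖)⁻¹ * s, ?_⟩
      rw [mul_smul, ← h, smul_smul, neg_mul_neg, inv_mul_cancel₀ (mul_ne_zero hbn hbn), one_smul]

open SimpleGraph in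
/-- Adding the vertices of a finite tree one at a time: each new vertex `w` has at most one
neighbour `v` among the old ones `S`, and cutting that edge separates `w` from `S`. -/
theorem SimpleGraph.IsTree.set_induction {V : Type*} [Finite V] {K : SimpleGraph V}
    (hK : K.IsTree) {P : Set V → Prop} (empty : P ∅)
    (step : ∀ (S B : Set V) (v w : V), w ∉ S → w ∈ B → Disjoint S B →
      (∀ a ∈ B, ∀ b ∉ B, K.Adj a b → a = w ∧ b = v ∧ v ∈ S) → P S → P (insert w S)) :
    P Set.univ := by
  have key : ∀ n ≤ Nat.card V, ∃ S : Set V, S.ncard = n ∧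
      (∀ H : SimpleGraph V, (∀ a ∈ S, ∀ b ∈ S, K.Adj a b → H.Adj a b) →
        ∀ a ∈ S, ∀ b ∈ S, H.Reachable a b) ∧ P S := by
    intro n
    induction n with
    | zero => exact fun _ => ⟨∅, by simp, by simp, empty⟩
    | succ n ih =>
      intro hn
      obtain ⟨S, hS, hconn, hP⟩ := ih (by omega)
      rcases S.eq_empty_or_nonempty with rfl | ⟨r, hr⟩
      · obtain ⟨r⟩ := hK.connected.nonempty
        refine ⟨insert r ∅, ?_, ?_, step ∅ Set.univ r r (by simp) (by simp) (by simp) (by simp) hP⟩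
        · rw [Set.ncard_insert_of_notMem (by simp), hS]
        · rintro H - a (rfl | h) b (rfl | h')
          · exact Reachable.refl _
          all_goals simp_all
      · obtain ⟨u, hu⟩ : ∃ u, u ∉ S := by
          by_contra! h
          rw [Set.eq_univ_of_forall h, Set.ncard_univ] at hS
          omega
        obtain ⟨p⟩ := hK.connected.preconnected r u
        obtain ⟨⟨⟨v, w⟩, hvw⟩, -, hv, hw⟩ := p.exists_boundary_dart S hr hu
        dsimp only at hv hw
        have hvw : K.Adj v w := hvw
        set H := K.deleteEdges {s(v, w)} with hH
        have hbr : ¬ H.Reachable v w :=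
          isBridge_iff.1 (isAcyclic_iff_forall_adj_isBridge.1 hK.isAcyclic hvw)
        have hSH : ∀ a ∈ S, ∀ b ∈ S, K.Adj a b → H.Adj a b := by
          intro a ha b hb hab
          rw [hH, deleteEdges_adj]
          refine ⟨hab, fun h => ?_⟩
          rcases Sym2.eq_iff.1 (Set.mem_singleton_iff.1 h) with ⟨rfl, rfl⟩ | ⟨rfl, rfl⟩
          · exact hw hb
          · exact hw ha
        refine ⟨insert w S, ?_, ?_, step S {u | H.Reachable w u} v w hw (Reachable.refl w) ?_ ?_ hP⟩
        · rw [Set.ncard_insert_of_notMem hw, hS]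
        · intro H' hH'
          have h1 := hconn H' fun a ha b hb => hH' a (Or.inr ha) b (Or.inr hb)
          have h2 : H'.Reachable v w := (hH' v (Or.inr hv) w (Or.inl rfl) hvw).reachable
          rintro a (rfl | ha) b (rfl | hb)
          · exact Reachable.refl _
          · exact h2.symm.trans (h1 v hv b hb)
          · exact (h1 a ha v hv).trans h2
          · exact h1 a ha b hb
        · refine Set.disjoint_left.2 fun a ha h => hbr ?_
          exact (hconn H hSH v hv a ha).trans (Reachable.symm h)
        · intro a ha b hb hab
          have : ¬ H.Adj a b := fun h => hb (Reachable.trans ha h.reachable)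
          rw [hH, deleteEdges_adj, not_and, not_not] at this
          rcases Sym2.eq_iff.1 (Set.mem_singleton_iff.1 (this hab)) with ⟨rfl, rfl⟩ | ⟨rfl, rfl⟩
          · exact absurd (Reachable.symm ha) hbr
          · exact ⟨rfl, rfl, hv⟩
  obtain ⟨S, hS, -, hP⟩ := key _ le_rfl
  have : S = Set.univ := Set.eq_of_subset_of_ncard_le (Set.subset_univ S) (by simp [hS])
  exact this ▸ hP

/-- Every labelling of the edges of a finite tree is the coboundary of a labelling of the
vertices. -/
theorem SimpleGraph.IsTree.exists_xor_eq {V : Type*} [Finite V] {K : SimpleGraph V}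
    (hK : K.IsTree) (ε : K.edgeSet → Bool) :
    ∃ c : V → Bool, ∀ v w (h : K.Adj v w), (c v ^^ c w) = ε ⟨s(v, w), h⟩ := by
  classical
  have := hK.set_induction (P := fun S => ∃ c : V → Bool,
    ∀ v ∈ S, ∀ w ∈ S, ∀ h : K.Adj v w, (c v ^^ c w) = ε ⟨s(v, w), h⟩) (by simp) ?_
  · simpa using this
  rintro S B v w hw hwB hSB hcross ⟨c, hc⟩
  have hS {b} (hb : b ∈ S) (h : K.Adj w b) : b = v :=
    (hcross w hwB b (Set.disjoint_left.1 hSB hb) h).2.1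
  have hne {b} (hb : b ∈ S) : b ≠ w := fun h => hw (h ▸ hb)
  refine ⟨Function.update c w (if h : K.Adj w v then c v ^^ ε ⟨s(w, v), h⟩ else true), ?_⟩
  rintro a (rfl | ha) b (rfl | hb) hab
  · exact absurd hab (K.irrefl)
  · obtain rfl := hS hb hab
    simp only [Function.update_self, Function.update_of_ne (hne hb), dif_pos hab]
    cases c b <;> simp
  · obtain rfl := hS ha hab.symm
    have : (⟨s(a, b), hab⟩ : K.edgeSet) = ⟨s(b, a), hab.symm⟩ := Subtype.ext Sym2.eq_swap
    simp [hne ha, hab.symm, this]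
  · simp [hne ha, hne hb, hc a ha b hb hab]

theorem natCard_connectedComponents_eq {X ι : Type*} [TopologicalSpace X] [Finite ι]
    (A : ι → Set X) (hclosed : ∀ i, IsClosed (A i)) (hconn : ∀ i, IsConnected (A i))
    (hdisj : ∀ i j x, x ∈ A i → x ∈ A j → i = j) (hcover : ∀ x, ∃ i, x ∈ A i) :
    Nat.card (ConnectedComponents X) = Nat.card ι := by
  choose x hx using fun i => (hconn i).nonempty
  have hclopen (i : ι) : IsClopen (A i) := by
    refine ⟨hclosed i, ?_⟩
    have : A i = (⋃ j ∈ {j | j ≠ i}, A j)ᶜ := by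
      ext y
      obtain ⟨k, hk⟩ := hcover y
      simp only [Set.mem_compl_iff, Set.mem_iUnion, not_exists, Set.mem_ofPred_eq]
      refine ⟨fun h j hj h' => hj (hdisj _ _ _ h' h), fun h => ?_⟩
      by_cases hki : k = i
      · exact hki ▸ hk
      · exact absurd hk (h k hki)
    rw [this]
    exact ((Set.toFinite _).isClosed_biUnion fun j _ => hclosed j).isOpen_compl
  refine (Nat.card_congr (Equiv.ofBijective (fun i => (x i : ConnectedComponents X)) ⟨?_, ?_⟩)).symm
  · intro i j hij
    have h := ConnectedComponents.coe_eq_coe'.1 hij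
    exact hdisj _ _ _ (hx i) ((hclopen j).connectedComponent_subset (hx j) h)
  · intro y
    obtain ⟨y, rfl⟩ := ConnectedComponents.surjective_coe y
    obtain ⟨i, hi⟩ := hcover y
    exact ⟨i, ConnectedComponents.coe_eq_coe'.2
      ((hconn i).isPreconnected.subset_connectedComponent hi (hx i))⟩

/-- The sign by which two quaternions lifting commuting rotations commute. -/
def commSign (b : Bool) : ℝ := if b then -1 else 1

theorem commSign_mul_self (b : Bool) : commSign b * commSign b = 1 := by
  cases b <;> simp [commSign]

theorem commSign_injective : Function.Injective commSign := by
  intro a b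
  cases a <;> cases b <;> norm_num [commSign]

section Lifts

variable {V : Type*} (K : SimpleGraph V) (ε : K.edgeSet → Bool)

/-- The tuples of nonzero quaternions which anticommute along the edges labelled `true` and
commute along the edges labelled `false`. -/
def quatLifts : Set (V → NonzeroQuat) :=
  {p | ∀ v w (h : K.Adj v w),
    (p v).1 * (p w).1 = commSign (ε ⟨s(v, w), h⟩) • ((p w).1 * (p v).1)}

/-- The part of the representation variety consisting of the tuples of rotations that lift to
quaternions with commutation signs prescribed by `ε`. -/
def repStratum : Set (V → SO3) := (fun p v => toSO3 (p v)) '' quatLifts K ε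

variable {K ε}

theorem repStratum_subset_repVar : repStratum K ε ⊆ RepVar K := by
  rintro _ ⟨p, hp, rfl⟩ v w h
  refine (toSO3_commute_iff _ _).2 ?_
  have := hp v w h
  cases hε : ε ⟨s(v, w), h⟩ <;> simp_all [commSign]

theorem exists_mem_repStratum {x : V → SO3} (hx : x ∈ RepVar K) :
    ∃ ε, x ∈ repStratum K ε := by
  classical
  choose p hp using fun v => toSO3_surjective (x v)
  refine ⟨fun e => decide (∃ v w, e.1 = s(v, w) ∧ (p v).1 * (p w).1 = -((p w).1 * (p v).1)), p,
    fun v w h => ?_, funext hp⟩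
  have hc := (toSO3_commute_iff (p v) (p w)).1 (by rw [hp, hp]; exact hx v w h)
  by_cases ha : (p v).1 * (p w).1 = -((p w).1 * (p v).1)
  · have : ∃ v' w', s(v, w) = s(v', w') ∧ (p v').1 * (p w').1 = -((p w').1 * (p v').1) :=
      ⟨v, w, rfl, ha⟩
    simp only [this, decide_true, commSign, if_true]
    simpa using ha
  · have : ¬ ∃ v' w', s(v, w) = s(v', w') ∧ (p v').1 * (p w').1 = -((p w').1 * (p v').1) := by
      rintro ⟨v', w', he, h'⟩
      rcases Sym2.eq_iff.1 he with ⟨rfl, rfl⟩ | ⟨rfl, rfl⟩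
      · exact ha h'
      · exact ha (by rw [h', neg_neg])
    simp only [this, decide_false, commSign]
    simpa using hc.resolve_right ha

theorem eq_of_mem_repStratum {ε' : K.edgeSet → Bool} {x : V → SO3} (h : x ∈ repStratum K ε)
    (h' : x ∈ repStratum K ε') : ε = ε' := by
  obtain ⟨p, hp, rfl⟩ := h
  obtain ⟨q, hq, hpq⟩ := h'
  choose c hc using fun v => toSO3_eq_iff.1 (congrFun hpq v)
  funext ⟨e, he⟩
  induction e with | _ v w
  have h1 := hp v w he
  rw [hc v, hc w] at h1
  simp only [smul_mul_assoc, mul_smul_comm] at h1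
  rw [hq v w he] at h1
  simp only [smul_smul] at h1
  have hne : (q w).1 * (q v).1 ≠ 0 := mul_ne_zero (q w).2 (q v).2
  have hcv (v : V) : c v ≠ 0 := by
    intro h0
    have := hc v
    rw [h0, zero_smul] at this
    exact (p v).2 this
  have h2 := smul_left_injective ℝ hne h1
  refine commSign_injective (mul_left_cancel₀ (mul_ne_zero (hcv v) (hcv w)) ?_)
  linarith

theorem isClosed_repStratum : IsClosed (repStratum K ε) := by
  have hne (q : Metric.sphere (0 : ℍ[ℝ]) 1) : q.1 ≠ 0 := ne_zero_of_mem_unit_sphere q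
  let f : (V → Metric.sphere (0 : ℍ[ℝ]) 1) → V → NonzeroQuat := fun p v => ⟨(p v).1, hne (p v)⟩
  have hf : Continuous f := by
    refine continuous_pi fun v => Continuous.subtype_mk ?_ _
    fun_prop
  have hcl : IsClosed (f ⁻¹' quatLifts K ε) := by
    have : f ⁻¹' quatLifts K ε = ⋂ (v) (w) (h : K.Adj v w),
        {p | (p v).1 * (p w).1 = commSign (ε ⟨s(v, w), h⟩) • ((p w).1 * (p v).1)} := by
      ext p
      simp [quatLifts, f]
    rw [this]
    refine isClosed_iInter fun v => isClosed_iInter fun w => isClosed_iInter fun h =>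
      isClosed_eq (by fun_prop) (by fun_prop)
  have hQ : Continuous fun (p : V → NonzeroQuat) v => toSO3 (p v) :=
    continuous_pi fun v => continuous_toSO3.comp (continuous_apply v)
  have hK := (hcl.isCompact.image (hQ.comp hf)).isClosed
  convert hK using 1
  ext x
  constructor
  · rintro ⟨p, hp, rfl⟩
    refine ⟨fun v => ⟨‖(p v).1‖⁻¹ • (p v).1, ?_⟩, fun v w h => ?_, funext fun v => ?_⟩
    · simp [norm_smul, (p v).2]
    · simp only [f, smul_mul_assoc, mul_smul_comm, hp v w h]
      module
    · exact (toSO3_eq_iff.2 ⟨_, rfl⟩).symm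
  · rintro ⟨p, hp, rfl⟩
    exact ⟨f p, hp, rfl⟩

theorem joinedIn_repStratum (f : unitInterval → V → NonzeroQuat) (hf : Continuous f)
    (h : ∀ t, f t ∈ quatLifts K ε) :
    JoinedIn (repStratum K ε) (fun v => toSO3 (f 0 v)) (fun v => toSO3 (f 1 v)) := by
  refine ⟨⟨⟨fun t v => toSO3 (f t v), ?_⟩, rfl, rfl⟩, fun t => ⟨f t, h t, rfl⟩⟩
  exact continuous_pi fun v => continuous_toSO3.comp ((continuous_apply v).comp hf)

/-- The vertices carrying a nontrivial half-turn in every tuple of the stratum. -/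
def IsMarked (ε : K.edgeSet → Bool) (v : V) : Prop :=
  ∃ w, ∃ h : K.Adj v w, ε ⟨s(v, w), h⟩ = true

theorem IsMarked.re_eq_zero {v : V} (h : IsMarked ε v) {p : V → NonzeroQuat}
    (hp : p ∈ quatLifts K ε) : (p v).1.re = 0 := by
  obtain ⟨w, hvw, hε⟩ := h
  refine re_eq_zero_of_anticommute (p w).2 ?_
  rw [hp v w hvw, hε]
  simp [commSign]

/-- All unmarked rotations can be moved to the identity. -/
theorem exists_joinedIn_eq_one {p : V → NonzeroQuat} (hp : p ∈ quatLifts K ε) :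
    ∃ q ∈ quatLifts K ε, (∀ v, ¬ IsMarked ε v → (q v).1 = 1) ∧
      JoinedIn (repStratum K ε) (fun v => toSO3 (p v)) (fun v => toSO3 (q v)) := by
  classical
  let s (v : V) : ℝ := if (p v).1.re < 0 then -1 else 1
  have hs0 (v : V) : s v ≠ 0 := by
    dsimp only [s]
    split_ifs <;> norm_num
  have hs (v : V) : 0 ≤ s v * (p v).1.re := by
    dsimp only [s]
    split_ifs <;> linarith
  let α (t : unitInterval) (v : V) : ℝ := if IsMarked ε v then 1 else (1 - t.1) * s v
  let β (t : unitInterval) (v : V) : ℝ := if IsMarked ε v then 0 else t.1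
  have hne (t : unitInterval) (v : V) : α t v • (p v).1 + β t v • 1 ≠ 0 := by
    by_cases hv : IsMarked ε v
    · simpa [α, β, hv] using (p v).2
    · intro h
      simp only [α, β, hv, if_false] at h
      have hre := congrArg QuaternionAlgebra.re h
      simp at hre
      have h1 : 0 ≤ (1 - t.1) * (s v * (p v).1.re) :=
        mul_nonneg (by linarith [t.2.2]) (hs v)
      have ht : t.1 = 0 := le_antisymm (by linarith) t.2.1
      rw [ht] at h
      simp [hs0 v, (p v).2] at h
  let f : unitInterval → V → NonzeroQuat := fun t v => ⟨_, hne t v⟩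
  have hf : Continuous f := by
    refine continuous_pi fun v => Continuous.subtype_mk ?_ _
    by_cases hv : IsMarked ε v <;> simp only [α, β, hv, if_true, if_false] <;> fun_prop
  have hmem (t : unitInterval) : f t ∈ quatLifts K ε := by
    intro v w h
    have hvw := hp v w h
    cases hε : ε ⟨s(v, w), h⟩
    · rw [hε] at hvw
      have hc : (p v).1 * (p w).1 = (p w).1 * (p v).1 := by simpa [commSign] using hvw
      replace hc : Commute (p v).1 (p w).1 := hc
      simp only [commSign, f]
      rw [if_neg (by simp), one_smul]
      exact ((((hc.smul_right _).add_right ((Commute.one_right _).smul_right _))).smul_left _).add_left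
        ((Commute.one_left _).smul_left _)
    · have hv : IsMarked ε v := ⟨w, h, hε⟩
      have hw : IsMarked ε w := ⟨v, h.symm, by rw [← hε]; congr 2; exact Sym2.eq_swap⟩
      rw [← hε]
      simpa [f, α, β, hv, hw] using hvw
  have hj := joinedIn_repStratum f hf hmem
  refine ⟨f 1, hmem 1, fun v hv => by simp [f, α, β, hv], ?_⟩
  convert hj using 2 with v
  refine toSO3_eq_iff.2 ⟨α 0 v, ?_⟩
  by_cases hv : IsMarked ε v <;> simp [f, α, β, hv]

/-- Conjugating the tuple on one side `B` of a cut by a quaternion that commutes with the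
entries just across the cut. -/
theorem exists_joinedIn_conj {p : V → NonzeroQuat} (hp : p ∈ quatLifts K ε) (B : Set V)
    {c : ℍ[ℝ]} (hc : ∀ t : ℝ, (1 - t) • 1 + t • c ≠ 0)
    (hB : ∀ a ∈ B, ∀ b ∉ B, K.Adj a b → Commute (p b).1 c) :
    ∃ q ∈ quatLifts K ε, (∀ v ∉ B, q v = p v) ∧ (∀ v ∈ B, (q v).1 * c = c * (p v).1) ∧
      JoinedIn (repStratum K ε) (fun v => toSO3 (p v)) (fun v => toSO3 (q v)) := by
  classical
  let γ (t : unitInterval) : ℍ[ℝ] := (1 - t.1) • 1 + t.1 • c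
  have hγ (t : unitInterval) : γ t ≠ 0 := hc t.1
  have hne (t : unitInterval) (v : V) :
      (if v ∈ B then γ t * (p v).1 * (γ t)⁻¹ else (p v).1) ≠ 0 := by
    split_ifs
    · exact mul_ne_zero (mul_ne_zero (hγ t) (p v).2) (inv_ne_zero (hγ t))
    · exact (p v).2
  let f : unitInterval → V → NonzeroQuat := fun t v => ⟨_, hne t v⟩
  have hf : Continuous f := by
    refine continuous_pi fun v => Continuous.subtype_mk ?_ _
    have h1 : Continuous γ := by fun_prop
    have h2 : Continuous fun t => (γ t)⁻¹ := h1.inv₀ hγ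
    by_cases hv : v ∈ B <;> simp only [hv, if_true, if_false] <;> fun_prop
  have hcomm {a b : V} (ha : a ∈ B) (hb : b ∉ B) (h : K.Adj a b) (t : unitInterval) :
      γ t * (p b).1 * (γ t)⁻¹ = (p b).1 := by
    have : Commute (p b).1 (γ t) :=
      ((Commute.one_right _).smul_right _).add_right ((hB a ha b hb h).smul_right _)
    rw [← this.eq, mul_inv_cancel_right₀ (hγ t)]
  have hconj {v w : V} (h : K.Adj v w) (t : unitInterval) :
      (γ t * (p v).1 * (γ t)⁻¹) * (γ t * (p w).1 * (γ t)⁻¹) = commSign (ε ⟨s(v, w), h⟩) •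
        ((γ t * (p w).1 * (γ t)⁻¹) * (γ t * (p v).1 * (γ t)⁻¹)) := by
    have key (x y : ℍ[ℝ]) :
        (γ t * x * (γ t)⁻¹) * (γ t * y * (γ t)⁻¹) = γ t * (x * y) * (γ t)⁻¹ := by
      simp only [mul_assoc, inv_mul_cancel_left₀ (hγ t)]
    rw [key, key, hp v w h, mul_smul_comm, smul_mul_assoc]
  have hmem (t : unitInterval) : f t ∈ quatLifts K ε := by
    intro v w h
    by_cases hv : v ∈ B <;> by_cases hw : w ∈ B <;> simp only [f, hv, hw, if_true, if_false]
    · exact hconj h t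
    · have := hconj h t
      rwa [hcomm hv hw h] at this
    · have := hconj h t
      rwa [hcomm hw hv h.symm] at this
    · exact hp v w h
  have hj := joinedIn_repStratum f hf hmem
  refine ⟨f 1, hmem 1, fun v hv => by simp [f, hv], fun v hv => ?_, ?_⟩
  · have hc0 : c ≠ 0 := by simpa using hc 1
    simp [f, hv, γ, hc0]
  · convert hj using 2 with v
    refine congrArg toSO3 (Subtype.ext ?_)
    simp [f, γ]

theorem joinedIn_repStratum_of_eq_one [Finite V] (hK : K.IsTree) {p q : V → NonzeroQuat}
    (hp : p ∈ quatLifts K ε) (hq : q ∈ quatLifts K ε) (hp1 : ∀ v, ¬ IsMarked ε v → (p v).1 = 1)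
    (hq1 : ∀ v, ¬ IsMarked ε v → (q v).1 = 1) :
    JoinedIn (repStratum K ε) (fun v => toSO3 (p v)) (fun v => toSO3 (q v)) := by
  have := hK.set_induction (P := fun S => ∃ r ∈ quatLifts K ε,
    (∀ v, ¬ IsMarked ε v → (r v).1 = 1) ∧
    JoinedIn (repStratum K ε) (fun v => toSO3 (p v)) (fun v => toSO3 (r v)) ∧
    ∀ v ∈ S, ∃ c : ℝ, (q v).1 = c • (r v).1)
    ⟨p, hp, hp1, JoinedIn.refl ⟨p, hp, rfl⟩, by simp⟩ ?_
  · obtain ⟨r, -, -, hj, hr⟩ := this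
    convert hj using 2 with v
    exact (toSO3_eq_iff.2 (hr v (Set.mem_univ v))).symm
  rintro S B v w - hwB hSB hcross ⟨r, hr, hr1, hj, hrq⟩
  by_cases hw : IsMarked ε w
  swap
  · refine ⟨r, hr, hr1, hj, ?_⟩
    rintro u (rfl | hu)
    · exact ⟨1, by rw [hr1 u hw, hq1 u hw, one_smul]⟩
    · exact hrq u hu
  obtain ⟨c, ⟨k, hk⟩, hcomm, hc⟩ :=
    exists_conj_eq (hw.re_eq_zero hr) (hw.re_eq_zero hq) (q w).2
  obtain ⟨r', hr', hr'B, hr'c, hj'⟩ := exists_joinedIn_conj hr B hc (by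
    intro a ha b hb hab
    obtain ⟨rfl, rfl, hbS⟩ := hcross a ha b hb hab
    obtain ⟨d, hd⟩ := hrq b hbS
    have hd0 : d ≠ 0 := by
      rintro rfl
      exact (q b).2 (by rw [hd, zero_smul])
    refine hcomm _ ?_
    have h1 := hr b a hab.symm
    have h2 := hq b a hab.symm
    rw [hd, smul_mul_assoc, mul_smul_comm, smul_comm] at h2
    have h2 := smul_right_injective _ hd0 h2
    rw [Commute, SemiconjBy, ← mul_assoc, h2, smul_mul_assoc, mul_assoc, h1, mul_smul_comm,
      smul_smul, commSign_mul_self, one_smul, mul_assoc])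
  have hc0 : c ≠ 0 := by simpa using hc 1
  refine ⟨r', hr', fun u hu => ?_, hj.trans hj', ?_⟩
  · by_cases huB : u ∈ B
    · have := hr'c u huB
      rw [hr1 u hu, mul_one] at this
      exact mul_right_cancel₀ hc0 (by rw [this, one_mul])
    · rw [hr'B u huB, hr1 u hu]
  · rintro u (rfl | hu)
    · have h := hr'c u hwB
      rw [hk, ← smul_mul_assoc] at h
      have h := mul_right_cancel₀ hc0 h
      have hk0 : k ≠ 0 := by
        rintro rfl
        exact (r' u).2 (by rw [h, zero_smul])
      exact ⟨k⁻¹, by rw [h, inv_smul_smul₀ hk0]⟩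
    · rw [hr'B u (Set.disjoint_left.1 hSB hu)]
      exact hrq u hu

theorem repStratum_nonempty [Finite V] (hK : K.IsTree) (ε : K.edgeSet → Bool) :
    (repStratum K ε).Nonempty := by
  obtain ⟨c, hc⟩ := hK.exists_xor_eq ε
  let i : NonzeroQuat := ⟨⟨0, 1, 0, 0⟩, fun h => by simpa using congrArg QuaternionAlgebra.imI h⟩
  let j : NonzeroQuat := ⟨⟨0, 0, 1, 0⟩, fun h => by simpa using congrArg QuaternionAlgebra.imJ h⟩
  have hij : i.1 * j.1 = -(j.1 * i.1) := by
    have hi : i.1.re = 0 ∧ i.1.imI = 1 ∧ i.1.imJ = 0 ∧ i.1.imK = 0 := ⟨rfl, rfl, rfl, rfl⟩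
    have hj : j.1.re = 0 ∧ j.1.imI = 0 ∧ j.1.imJ = 1 ∧ j.1.imK = 0 := ⟨rfl, rfl, rfl, rfl⟩
    ext <;> simp [hi, hj]
  refine ⟨_, fun v => if c v then i else j, fun v w h => ?_, rfl⟩
  rw [← hc v w h]
  rcases hv : c v <;> rcases hw : c w <;> simp [commSign, hv, hw, hij]

theorem isConnected_repStratum [Finite V] (hK : K.IsTree) (ε : K.edgeSet → Bool) :
    IsConnected (repStratum K ε) := by
  refine IsPathConnected.isConnected (isPathConnected_iff.2 ⟨repStratum_nonempty hK ε, ?_⟩)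
  rintro _ ⟨p, hp, rfl⟩ _ ⟨q, hq, rfl⟩
  obtain ⟨p', hp', hp1, hpj⟩ := exists_joinedIn_eq_one hp
  obtain ⟨q', hq', hq1, hqj⟩ := exists_joinedIn_eq_one hq
  exact hpj.trans ((joinedIn_repStratum_of_eq_one hK hp' hq' hp1 hq1).trans hqj.symm)

end Lifts

theorem card_connectedComponents_repVar_tree
    {V : Type} [Fintype V] (K : SimpleGraph V) (hK : K.IsTree) :
    Nat.card (ConnectedComponents (RepVar K)) = 2 ^ Nat.card K.edgeSet := by
  rw [natCard_connectedComponents_eq (ι := K.edgeSet → Bool)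
    (fun ε => (Subtype.val ⁻¹' repStratum K ε : Set (RepVar K))), Nat.card_fun]
  · simp
  · exact fun ε => isClosed_repStratum.preimage continuous_subtype_val
  · intro ε
    have himg : Subtype.val '' (Subtype.val ⁻¹' repStratum K ε : Set (RepVar K)) =
        repStratum K ε := by
      rw [Subtype.image_preimage_coe, Set.inter_eq_right]
      exact repStratum_subset_repVar
    have hconn := isConnected_repStratum hK ε
    refine ⟨?_, Topology.IsInducing.subtypeVal.isPreconnected_image.1 ?_⟩
    · rw [← Set.image_nonempty, himg]
      exact hconn.nonempty
    · rw [himg]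
      exact hconn.isPreconnected
  · exact fun _ _ _ => eq_of_mem_repStratum
  · exact fun x => exists_mem_repStratum x.2

end
end

section
/- If K is the cycle graph on n ≥ 3 vertices (which has exactly n edges), then the representation variety R(K, SO(3)) has exactly 2^n connected components. -/
noncomputable section

section Rotations

open Quaternion Matrix

/-- The matrix of `x ↦ q * x * star q` on the imaginary quaternions. -/
def conjMatrix (q : ℍ) : Matrix (Fin 3) (Fin 3) ℝ :=
  !![q.re ^ 2 + q.imI ^ 2 - q.imJ ^ 2 - q.imK ^ 2, 2 * (q.imI * q.imJ - q.re * q.imK),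
      2 * (q.imI * q.imK + q.re * q.imJ);
    2 * (q.imI * q.imJ + q.re * q.imK), q.re ^ 2 - q.imI ^ 2 + q.imJ ^ 2 - q.imK ^ 2,
      2 * (q.imJ * q.imK - q.re * q.imI);
    2 * (q.imI * q.imK - q.re * q.imJ), 2 * (q.imJ * q.imK + q.re * q.imI),
      q.re ^ 2 - q.imI ^ 2 - q.imJ ^ 2 + q.imK ^ 2]

/-- The rotation `x ↦ q * x * q⁻¹` of the imaginary quaternions, as a matrix. -/
def rot (q : ℍ) : Matrix (Fin 3) (Fin 3) ℝ := (normSq q)⁻¹ • conjMatrix q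

lemma conjMatrix_mul (p q : ℍ) : conjMatrix (p * q) = conjMatrix p * conjMatrix q := by
  ext i j
  fin_cases i <;> fin_cases j <;>
    simp [conjMatrix, Matrix.mul_apply, Fin.sum_univ_three] <;> ring

lemma conjMatrix_smul (s : ℝ) (q : ℍ) : conjMatrix (s • q) = s ^ 2 • conjMatrix q := by
  ext i j
  fin_cases i <;> fin_cases j <;> simp [conjMatrix] <;> ring

lemma rot_mul (p q : ℍ) : rot (p * q) = rot p * rot q := by
  simp [rot, conjMatrix_mul, smul_smul, mul_comm]

lemma rot_smul {s : ℝ} (hs : s ≠ 0) (q : ℍ) : rot (s • q) = rot q := by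
  rw [rot, rot, conjMatrix_smul, normSq_smul, smul_smul]
  congr 1
  field_simp

lemma rot_mem {q : ℍ} (hq : q ≠ 0) : rot q * (rot q)ᵀ = 1 ∧ (rot q).det = 1 := by
  have h : normSq q ≠ 0 := normSq_ne_zero.2 hq
  constructor
  · have : conjMatrix q * (conjMatrix q)ᵀ = (normSq q) ^ 2 • 1 := by
      ext i j
      fin_cases i <;> fin_cases j <;>
        simp [conjMatrix, Matrix.mul_apply, Fin.sum_univ_three, normSq_def'] <;> ring
    rw [rot, Matrix.transpose_smul, Matrix.smul_mul, Matrix.mul_smul, this, smul_smul, smul_smul]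
    convert one_smul ℝ _
    field_simp
  · have : (conjMatrix q).det = normSq q ^ 3 := by
      simp [conjMatrix, Matrix.det_fin_three, normSq_def']
      ring
    rw [rot, Matrix.det_smul, this]
    simp [h]

lemma continuousAt_rot {q : ℍ} (hq : q ≠ 0) : ContinuousAt rot q := by
  have h : normSq q ≠ 0 := normSq_ne_zero.2 hq
  have h1 : Continuous conjMatrix := by
    have h0 := Quaternion.continuous_re
    have h1 := Quaternion.continuous_imI
    have h2 := Quaternion.continuous_imJ
    have h3 := Quaternion.continuous_imK
    refine continuous_matrix fun i j => ?_
    fin_cases i <;> fin_cases j <;> simp [conjMatrix] <;> fun_prop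
  exact (continuous_normSq.continuousAt.inv₀ h).smul h1.continuousAt

lemma trace_rot (q : ℍ) : (rot q).trace = (normSq q)⁻¹ * (4 * q.re ^ 2 - normSq q) := by
  simp [rot, conjMatrix, Matrix.trace, Fin.sum_univ_three, normSq_def']
  ring

lemma exists_quaternion (a b c d : ℝ) :
    ∃ q : ℍ, q.re = a ∧ q.imI = b ∧ q.imJ = c ∧ q.imK = d :=
  ⟨⟨a, b, c, d⟩, rfl, rfl, rfl, rfl⟩

lemma exists_rot_col_eq {w : Fin 3 → ℝ} (hw : w 0 ^ 2 + w 1 ^ 2 + w 2 ^ 2 = 1) :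
    ∃ q : ℍ, q ≠ 0 ∧ ∀ i, rot q i 0 = w i := by
  by_cases h : 1 + w 0 = 0
  · have h0 : w 0 = -1 := by linarith
    have h1 : w 1 = 0 := by nlinarith [sq_nonneg (w 1), sq_nonneg (w 2)]
    have h2 : w 2 = 0 := by nlinarith [sq_nonneg (w 1), sq_nonneg (w 2)]
    obtain ⟨q, q0, q1, q2, q3⟩ := exists_quaternion 0 0 1 0
    refine ⟨q, fun hq => by simp [hq] at q2, fun i => ?_⟩
    fin_cases i <;> simp [rot, conjMatrix, normSq_def', h0, h1, h2, q0, q1, q2, q3]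
  · obtain ⟨q, q0, q1, q2, q3⟩ := exists_quaternion 0 (1 + w 0) (w 1) (w 2)
    have hN : normSq q = 2 * (1 + w 0) := by
      simp only [normSq_def', q0, q1, q2, q3]
      linear_combination hw
    refine ⟨q, normSq_ne_zero.1 (by rw [hN]; positivity), fun i => ?_⟩
    fin_cases i <;> simp [rot, conjMatrix, hN, q0, q1, q2, q3] <;> field_simp
    linear_combination -hw

lemma exists_rot_eq_of_col {B : Matrix (Fin 3) (Fin 3) ℝ} (hB : B * Bᵀ = 1) (hdet : B.det = 1)
    (hcol : ∀ i, B i 0 = (1 : Matrix (Fin 3) (Fin 3) ℝ) i 0) :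
    ∃ q : ℍ, q ≠ 0 ∧ rot q = B := by
  have h00 : B 0 0 = 1 := by simpa using hcol 0
  have h10 : B 1 0 = 0 := by simpa using hcol 1
  have h20 : B 2 0 = 0 := by simpa using hcol 2
  have e i j := congrFun (congrFun hB i) j
  have e00 := e 0 0
  have e11 := e 1 1
  have e22 := e 2 2
  simp [Matrix.mul_apply, Fin.sum_univ_three, h00, h10, h20] at e00 e11 e22
  simp [Matrix.det_fin_three, h00, h10, h20] at hdet
  have h01 : B 0 1 = 0 := by nlinarith [sq_nonneg (B 0 1), sq_nonneg (B 0 2)]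
  have h02 : B 0 2 = 0 := by nlinarith [sq_nonneg (B 0 1), sq_nonneg (B 0 2)]
  have h22 : B 2 2 = B 1 1 := by nlinarith [sq_nonneg (B 2 2 - B 1 1), sq_nonneg (B 1 2 + B 2 1)]
  have h12 : B 1 2 = -B 2 1 := by nlinarith [sq_nonneg (B 2 2 - B 1 1), sq_nonneg (B 1 2 + B 2 1)]
  have hcs : B 1 1 ^ 2 + B 2 1 ^ 2 = 1 := by rw [h12] at e11; linarith
  by_cases h : 1 + B 1 1 = 0
  · have h11 : B 1 1 = -1 := by linarith
    have h21 : B 2 1 = 0 := by nlinarith [sq_nonneg (B 2 1)]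
    obtain ⟨q, q0, q1, q2, q3⟩ := exists_quaternion 0 1 0 0
    refine ⟨q, fun hq => by simp [hq] at q1, ?_⟩
    ext i j
    fin_cases i <;> fin_cases j <;>
      simp [rot, conjMatrix, normSq_def', h00, h01, h02, h10, h11, h12, h20, h21, h22,
        q0, q1, q2, q3]
  · obtain ⟨q, q0, q1, q2, q3⟩ := exists_quaternion (1 + B 1 1) (B 2 1) 0 0
    have hN : normSq q = 2 * (1 + B 1 1) := by
      simp only [normSq_def', q0, q1, q2, q3]
      linear_combination hcs
    refine ⟨q, normSq_ne_zero.1 (by rw [hN]; positivity), ?_⟩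
    have h3 : B 2 1 ^ 2 = 1 - B 1 1 ^ 2 := by linarith
    ext i j
    fin_cases i <;> fin_cases j <;>
      simp [rot, conjMatrix, hN, h00, h01, h02, h10, h12, h20, h22, h3, q0, q1, q2, q3] <;>
       field_simp <;> ring

lemma exists_rot_eq {A : Matrix (Fin 3) (Fin 3) ℝ} (hA : A * Aᵀ = 1) (hdet : A.det = 1) :
    ∃ q : ℍ, q ≠ 0 ∧ rot q = A := by
  have hA' : Aᵀ * A = 1 := mul_eq_one_comm.1 hA
  have hcol : A 0 0 ^ 2 + A 1 0 ^ 2 + A 2 0 ^ 2 = 1 := by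
    have := congrFun (congrFun hA' 0) 0
    simp [Matrix.mul_apply, Fin.sum_univ_three] at this
    linarith
  obtain ⟨p, hp, hpA⟩ := exists_rot_col_eq (w := fun i => A i 0) hcol
  obtain ⟨hr, hrdet⟩ := rot_mem hp
  have hr' : (rot p)ᵀ * rot p = 1 := mul_eq_one_comm.1 hr
  obtain ⟨q, hq, hqB⟩ := exists_rot_eq_of_col (B := (rot p)ᵀ * A)
    (by rw [Matrix.transpose_mul, Matrix.transpose_transpose, Matrix.mul_assoc,
          ← Matrix.mul_assoc A, hA, Matrix.one_mul, hr'])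
    (by rw [Matrix.det_mul, Matrix.det_transpose, hrdet, hdet, one_mul])
    (by
      intro i
      rw [← congrFun (congrFun hr' i) 0]
      simp [Matrix.mul_apply, hpA])
  exact ⟨p * q, mul_ne_zero hp hq, by rw [rot_mul, hqB, ← Matrix.mul_assoc, hr, Matrix.one_mul]⟩

lemma eq_or_eq_neg_of_rot_eq {p q : ℍ} (hp : p ≠ 0) (hn : normSq p = normSq q)
    (h : rot p = rot q) : p = q ∨ p = -q := by
  have hq : normSq p ≠ 0 := normSq_ne_zero.2 hp
  have h1 : conjMatrix p = conjMatrix q := by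
    rw [rot, rot, ← hn] at h
    exact smul_right_injective _ (inv_ne_zero hq) h
  have e i j := congrFun (congrFun h1 i) j
  have e00 := e 0 0
  have e01 := e 0 1
  have e02 := e 0 2
  have e10 := e 1 0
  have e11 := e 1 1
  have e12 := e 1 2
  have e20 := e 2 0
  have e21 := e 2 1
  have e22 := e 2 2
  simp [conjMatrix] at e00 e01 e02 e10 e11 e12 e20 e21 e22
  simp only [normSq_def'] at hn
  have s00 : p.re * p.re - q.re * q.re = 0 := by linear_combination (hn + e00 + e11 + e22) / 4
  have s01 : p.re * p.imI - q.re * q.imI = 0 := by linear_combination (e21 - e12) / 2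
  have s02 : p.re * p.imJ - q.re * q.imJ = 0 := by linear_combination (e02 - e20) / 2
  have s03 : p.re * p.imK - q.re * q.imK = 0 := by linear_combination (e10 - e01) / 2
  have s11 : p.imI * p.imI - q.imI * q.imI = 0 := by linear_combination (hn + e00 - e11 - e22) / 4
  have s12 : p.imI * p.imJ - q.imI * q.imJ = 0 := by linear_combination (e01 + e10) / 2
  have s13 : p.imI * p.imK - q.imI * q.imK = 0 := by linear_combination (e02 + e20) / 2
  have s22 : p.imJ * p.imJ - q.imJ * q.imJ = 0 := by linear_combination (hn - e00 + e11 - e22) / 4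
  have s23 : p.imJ * p.imK - q.imJ * q.imK = 0 := by linear_combination (e12 + e21) / 2
  have s33 : p.imK * p.imK - q.imK * q.imK = 0 := by linear_combination (hn - e00 - e11 + e22) / 4
  have key : normSq (p - q) * normSq (p + q) = 0 := by
    simp only [normSq_def', re_sub, imI_sub, imJ_sub, imK_sub, re_add, imI_add, imJ_add, imK_add]
    linear_combination (p.re * p.re - q.re * q.re) * s00 +
      (p.imI * p.imI - q.imI * q.imI) * s11 +
      (p.imJ * p.imJ - q.imJ * q.imJ) * s22 +
      (p.imK * p.imK - q.imK * q.imK) * s33 +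
      4 * (p.re * p.imI - q.re * q.imI) * s01 +
      4 * (p.re * p.imJ - q.re * q.imJ) * s02 +
      4 * (p.re * p.imK - q.re * q.imK) * s03 +
      4 * (p.imI * p.imJ - q.imI * q.imJ) * s12 +
      4 * (p.imI * p.imK - q.imI * q.imK) * s13 +
      4 * (p.imJ * p.imK - q.imJ * q.imK) * s23 -
      2 * (p.re * p.re - q.re * q.re) * s11 -
      2 * (p.re * p.re - q.re * q.re) * s22 -
      2 * (p.re * p.re - q.re * q.re) * s33 -
      2 * (p.imI * p.imI - q.imI * q.imI) * s22 -
      2 * (p.imI * p.imI - q.imI * q.imI) * s33 -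
      2 * (p.imJ * p.imJ - q.imJ * q.imJ) * s33
  rcases mul_eq_zero.1 key with h | h
  · exact Or.inl (sub_eq_zero.1 (normSq_eq_zero.1 h))
  · exact Or.inr (eq_neg_of_add_eq_zero_left (normSq_eq_zero.1 h))

end Rotations

section QuaternionRelations

open Quaternion

/-- Two quaternions are parallel if they differ by a nonzero real factor. -/
def Parallel (p q : ℍ) : Prop := ∃ s : ℝ, s ≠ 0 ∧ q = s • p

namespace Parallel

variable {p q r u v w : ℍ} {ε : ℝ}

lemma refl (p : ℍ) : Parallel p p := ⟨1, one_ne_zero, (one_smul ℝ p).symm⟩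

lemma symm : Parallel p q → Parallel q p := by
  rintro ⟨s, hs, rfl⟩
  exact ⟨s⁻¹, inv_ne_zero hs, by rw [smul_smul, inv_mul_cancel₀ hs, one_smul]⟩

lemma trans : Parallel p q → Parallel q r → Parallel p r := by
  rintro ⟨s, hs, rfl⟩ ⟨t, ht, rfl⟩
  exact ⟨t * s, mul_ne_zero ht hs, smul_smul _ _ _⟩

lemma ne_zero : Parallel p q → p ≠ 0 → q ≠ 0 := by
  rintro ⟨s, hs, rfl⟩ hp
  exact smul_ne_zero hs hp

lemma rot_eq : Parallel p q → rot p = rot q := by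
  rintro ⟨s, hs, rfl⟩
  exact (rot_smul hs p).symm

lemma mul_comm_right : Parallel u v → w * u = ε • (u * w) → w * v = ε • (v * w) := by
  rintro ⟨s, -, rfl⟩ h
  rw [mul_smul_comm, h, smul_mul_assoc, smul_comm]

lemma mul_comm_left : Parallel u v → u * w = ε • (w * u) → v * w = ε • (w * v) := by
  rintro ⟨s, -, rfl⟩ h
  rw [smul_mul_assoc, h, mul_smul_comm, smul_comm]

end Parallel

lemma mul_eq_neg_smul_symm {p q : ℍ} (h : p * q = (-1 : ℝ) • (q * p)) :
    q * p = (-1 : ℝ) • (p * q) := by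
  rw [h, smul_smul]; simp

lemma Quaternion.re_mul_comm (p q : ℍ) : (p * q).re = (q * p).re := by
  simp only [re_mul]; ring

lemma re_eq_zero_of_mul_eq_neg {p q : ℍ} (hp : p ≠ 0) (h : q * p = (-1 : ℝ) • (p * q)) :
    q.re = 0 := by
  have h1 : (p⁻¹ * (q * p)).re = q.re := by
    rw [Quaternion.re_mul_comm, mul_assoc, mul_inv_cancel₀ hp, mul_one]
  have h2 : (p⁻¹ * (q * p)).re = -q.re := by
    rw [h, mul_smul_comm, ← mul_assoc, inv_mul_cancel₀ hp, one_mul]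
    simp
  linarith

lemma mul_self_of_re_eq_zero_s2 {p : ℍ} (hp : p.re = 0) : p * p = ((-normSq p : ℝ) : ℍ) := by
  rw [normSq_def']
  ext <;> simp only [re_mul, imI_mul, imJ_mul, imK_mul, re_coe, imI_coe, imJ_coe, imK_coe, hp] <;>
    ring

lemma parallel_of_commute {p q : ℍ} (hp : p ≠ 0) (hq : q ≠ 0) (hp0 : p.re = 0) (hq0 : q.re = 0)
    (h : Commute p q) : Parallel p q := by
  have hN : normSq p ≠ 0 := normSq_ne_zero.2 hp
  have hr : q * p = (((q * p).re : ℝ) : ℍ) := by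
    have h' : p * q = q * p := h
    have h1 := congrArg QuaternionAlgebra.imI h'
    have h2 := congrArg QuaternionAlgebra.imJ h'
    have h3 := congrArg QuaternionAlgebra.imK h'
    simp [hp0, hq0] at h1 h2 h3
    ext <;> simp [hp0, hq0] <;> linarith
  have hq' : q = (-(q * p).re / normSq p) • p := by
    have h1 : q * p * p = (q * p).re • p := by
      conv_lhs => rw [hr]
      rw [coe_mul_eq_smul]
    rw [mul_assoc, mul_self_of_re_eq_zero_s2 hp0, mul_coe_eq_smul] at h1
    rw [neg_div, neg_smul, div_eq_inv_mul, mul_smul, ← h1, smul_smul, mul_neg,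
      inv_mul_cancel₀ hN, neg_smul, one_smul, neg_neg]
  refine ⟨_, fun h0 => hq ?_, hq'⟩
  rw [hq', h0, zero_smul]

lemma commute_mul_of_mul_comm {u v w : ℍ} {ε : ℝ} (hε : ε * ε = 1) (hu : w * u = ε • (u * w))
    (hv : w * v = ε • (v * w)) : Commute w (v * u) := by
  show w * (v * u) = v * u * w
  rw [← mul_assoc, hv, smul_mul_assoc, mul_assoc, hu, mul_smul_comm, smul_smul, hε, one_smul,
    mul_assoc]

/-- A segment of invertible quaternions from `1` whose end conjugates `u` to a multiple of `v`,
inside the centralizer of everything that commutes or anticommutes with both `u` and `v`. -/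
lemma exists_conj_parallel {u v : ℍ} (hu : u ≠ 0) (hv : v ≠ 0) (hu0 : u.re = 0) (hv0 : v.re = 0) :
    ∃ d : ℍ, (∀ t ∈ unitInterval, 1 + t • d ≠ 0) ∧ Parallel ((1 + d) * u * (1 + d)⁻¹) v ∧
      ∀ (w : ℍ) (ε : ℝ), ε * ε = 1 → w * u = ε • (u * w) → w * v = ε • (v * w) → Commute w d := by
  obtain ⟨s, hs, hre, hnorm⟩ : ∃ s : ℝ, s ≠ 0 ∧ s * (v * u).re ≤ 0 ∧
      s ^ 2 * normSq v = normSq u := by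
    have hU : 0 < normSq u := lt_of_le_of_ne normSq_nonneg (normSq_ne_zero.2 hu).symm
    have hV : 0 < normSq v := lt_of_le_of_ne normSq_nonneg (normSq_ne_zero.2 hv).symm
    have hr : 0 < √(normSq u / normSq v) := Real.sqrt_pos.2 (div_pos hU hV)
    have hr2 : √(normSq u / normSq v) ^ 2 * normSq v = normSq u := by
      rw [Real.sq_sqrt (div_pos hU hV).le, div_mul_cancel₀ _ hV.ne']
    rcases le_total (v * u).re 0 with h | h
    · exact ⟨_, hr.ne', mul_nonpos_of_nonneg_of_nonpos hr.le h, hr2⟩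
    · exact ⟨_, (neg_neg_of_pos hr).ne, by nlinarith, by rw [neg_sq, hr2]⟩
  have hN : normSq u ≠ 0 := normSq_ne_zero.2 hu
  have hNpos : 0 < normSq u := lt_of_le_of_ne normSq_nonneg hN.symm
  set d : ℍ := (-(s / normSq u)) • (v * u) with hd
  have hdre : 0 ≤ d.re := by
    rw [hd, re_smul, smul_eq_mul, neg_mul, div_mul_eq_mul_div, neg_nonneg]
    exact div_nonpos_of_nonpos_of_nonneg hre hNpos.le
  have hne : ∀ t ∈ unitInterval, 1 + t • d ≠ 0 := by
    intro t ht h0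
    have := congrArg QuaternionAlgebra.re h0
    simp at this
    nlinarith [mul_nonneg ht.1 hdre]
  refine ⟨d, hne, ?_, fun w ε hε h1 h2 =>
    (commute_mul_of_mul_comm hε h1 h2).smul_right _⟩
  have h1 : 1 + d ≠ 0 := by simpa using hne 1 ⟨zero_le_one, le_rfl⟩
  have h2 : (1 + d) * u = (s • v) * (1 + d) := by
    have hdu : d * u = s • v := by
      rw [hd, smul_mul_assoc, mul_assoc, mul_self_of_re_eq_zero_s2 hu0, mul_coe_eq_smul, smul_smul]
      congr 1
      field_simp
    have hvd : (s • v) * d = u := by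
      rw [hd, mul_smul_comm, smul_mul_assoc, ← mul_assoc, mul_self_of_re_eq_zero_s2 hv0,
        coe_mul_eq_smul, smul_smul, smul_smul]
      convert one_smul ℝ u
      field_simp
      linear_combination hnorm
    rw [add_mul, mul_add, one_mul, mul_one, hdu, hvd, add_comm]
  rw [h2, mul_assoc, mul_inv_cancel₀ h1, mul_one]
  exact Parallel.symm ⟨s, hs, rfl⟩

lemma mul_eq_or_of_commute_rot {p q : ℍ} (hp : p ≠ 0) (hq : q ≠ 0)
    (h : rot p * rot q = rot q * rot p) : p * q = q * p ∨ p * q = (-1 : ℝ) • (q * p) := by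
  rw [← rot_mul, ← rot_mul] at h
  simpa using eq_or_eq_neg_of_rot_eq (mul_ne_zero hp hq) (by rw [map_mul, map_mul, mul_comm]) h

/-- The sum of the traces of `A`, `B` and `A * B`, which separates the two kinds of commuting
pairs of rotations. -/
def traceSum (A B : Matrix (Fin 3) (Fin 3) ℝ) : ℝ := A.trace + B.trace + (A * B).trace

lemma traceSum_of_commute {p q : ℍ} (hp : p ≠ 0) (hq : q ≠ 0) (h : p * q = q * p) :
    -1 ≤ traceSum (rot p) (rot q) := by
  have hP : 0 < normSq p := lt_of_le_of_ne normSq_nonneg (normSq_ne_zero.2 hp).symm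
  have hQ : 0 < normSq q := lt_of_le_of_ne normSq_nonneg (normSq_ne_zero.2 hq).symm
  have h1 := congrArg QuaternionAlgebra.imI h
  have h2 := congrArg QuaternionAlgebra.imJ h
  have h3 := congrArg QuaternionAlgebra.imK h
  simp at h1 h2 h3
  have key : (p * q).re ^ 2 + normSq q * p.re ^ 2 + normSq p * q.re ^ 2 =
      normSq p * normSq q + 2 * (p.re * q.re * (p * q).re) := by
    have c1 : p.imJ * q.imK - p.imK * q.imJ = 0 := by linarith
    have c2 : p.imK * q.imI - p.imI * q.imK = 0 := by linarith
    have c3 : p.imI * q.imJ - p.imJ * q.imI = 0 := by linarith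
    simp only [normSq_def', re_mul]
    linear_combination -(p.imJ * q.imK - p.imK * q.imJ) * c1 -
      (p.imK * q.imI - p.imI * q.imK) * c2 - (p.imI * q.imJ - p.imJ * q.imI) * c3
  have hq0 : q.re ^ 2 ≤ normSq q := by
    rw [normSq_def']; nlinarith [sq_nonneg q.imI, sq_nonneg q.imJ, sq_nonneg q.imK]
  have hle : normSq p * normSq q ≤
      2 * ((p * q).re ^ 2 + normSq q * p.re ^ 2 + normSq p * q.re ^ 2) := by
    nlinarith [sq_nonneg (p.re * q.re + (p * q).re), mul_nonneg (sq_nonneg p.re) (sub_nonneg.2 hq0),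
      mul_nonneg hP.le (sq_nonneg q.re)]
  rw [traceSum, ← rot_mul, trace_rot, trace_rot, trace_rot, map_mul]
  have : (normSq p)⁻¹ * (4 * p.re ^ 2 - normSq p) + (normSq q)⁻¹ * (4 * q.re ^ 2 - normSq q) +
      (normSq p * normSq q)⁻¹ * (4 * (p * q).re ^ 2 - normSq p * normSq q) =
      2 * ((2 * ((p * q).re ^ 2 + normSq q * p.re ^ 2 + normSq p * q.re ^ 2)) /
        (normSq p * normSq q)) - 3 := by
    field_simp
    ring
  rw [this]
  linarith [(one_le_div (mul_pos hP hQ)).2 hle]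

lemma traceSum_of_anticommute {p q : ℍ} (hp : p ≠ 0) (hq : q ≠ 0)
    (h : p * q = (-1 : ℝ) • (q * p)) : traceSum (rot p) (rot q) = -3 := by
  have hP : normSq p ≠ 0 := normSq_ne_zero.2 hp
  have hQ : normSq q ≠ 0 := normSq_ne_zero.2 hq
  have h1 := re_eq_zero_of_mul_eq_neg hq h
  have h2 := re_eq_zero_of_mul_eq_neg hp (mul_eq_neg_smul_symm h)
  have h3 : (p * q).re = 0 := by
    have := congrArg QuaternionAlgebra.re h
    rw [re_smul, Quaternion.re_mul_comm q p, smul_eq_mul] at this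
    linarith
  rw [traceSum, ← rot_mul, trace_rot, trace_rot, trace_rot, map_mul, h1, h2, h3]
  field_simp
  ring

end QuaternionRelations

section Configurations

open Quaternion

variable {ι κ : Type*}

lemma conj_mul_conj {c p q : ℍ} {ε : ℝ} (hc : c ≠ 0) (h : p * q = ε • (q * p)) :
    (c * p * c⁻¹) * (c * q * c⁻¹) = ε • ((c * q * c⁻¹) * (c * p * c⁻¹)) := by
  have key (a b : ℍ) : (c * a * c⁻¹) * (c * b * c⁻¹) = c * (a * b) * c⁻¹ := by
    simp only [mul_assoc, inv_mul_cancel_left₀ hc]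
  rw [key, key, h, mul_smul_comm, smul_mul_assoc]

lemma conj_eq_of_commute {c w : ℍ} (hc : c ≠ 0) (h : Commute w c) : c * w * c⁻¹ = w := by
  rw [← h.eq, mul_assoc, mul_inv_cancel₀ hc, mul_one]

/-- Families of nonzero quaternions subject to unary constraints `C` and to the relations
`q i * q j = ε • (q j * q i)` for all labelled edges `E i j ε`. -/
def Conf (E : ι → ι → ℝ → Prop) (C : ι → Set ℍ) : Set (ι → ℍ) :=
  {q | (∀ i, q i ≠ 0) ∧ (∀ i, q i ∈ C i) ∧ ∀ i j ε, E i j ε → q i * q j = ε • (q j * q i)}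

/-- The family of rotations associated with a family of quaternions. -/
def rotMap (q : ι → ℍ) : ι → Matrix (Fin 3) (Fin 3) ℝ := fun i => rot (q i)

/-- Two families of quaternions are joined in `S` up to the passage to rotations. -/
def RotJoined (S : Set (ι → ℍ)) (x y : ι → ℍ) : Prop :=
  JoinedIn (rotMap '' S) (rotMap x) (rotMap y)

namespace RotJoined

variable {S T : Set (ι → ℍ)} {x y z : ι → ℍ}

lemma symm (h : RotJoined S x y) : RotJoined S y x := JoinedIn.symm h

lemma trans (h : RotJoined S x y) (h' : RotJoined S y z) : RotJoined S x z := JoinedIn.trans h h'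

lemma mono (h : RotJoined S x y) (hST : S ⊆ T) : RotJoined T x y :=
  JoinedIn.mono h (Set.image_mono hST)

lemma of_parallel (hx : x ∈ S) (h : ∀ i, Parallel (x i) (y i)) : RotJoined S x y := by
  have : rotMap y = rotMap x := funext fun i => (h i).rot_eq.symm
  rw [RotJoined, this]
  exact JoinedIn.refl ⟨x, hx, rfl⟩

lemma refl (hx : x ∈ S) : RotJoined S x x := of_parallel hx fun i => Parallel.refl (x i)

lemma of_path (γ : ℝ → ι → ℍ) (hS : ∀ t ∈ unitInterval, γ t ∈ S)
    (h0 : ∀ t ∈ unitInterval, ∀ i, γ t i ≠ 0)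
    (hγ : ∀ i, ContinuousOn (fun t => γ t i) unitInterval) : RotJoined S (γ 0) (γ 1) := by
  refine JoinedIn.ofLine (f := fun t => rotMap (γ t)) ?_ rfl rfl ?_
  · exact continuousOn_pi.2 fun i t ht =>
      ContinuousAt.comp_continuousWithinAt (f := fun t => γ t i) (g := rot)
        (continuousAt_rot (h0 t ht i)) (hγ i t ht)
  · rintro _ ⟨t, ht, rfl⟩
    exact ⟨γ t, hS t ht, rfl⟩

lemma map {T : Set (κ → ℍ)} (h : RotJoined S x y) (f : (ι → ℍ) → κ → ℍ)
    (F : (ι → Matrix (Fin 3) (Fin 3) ℝ) → κ → Matrix (Fin 3) (Fin 3) ℝ) (hF : Continuous F)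
    (hfF : ∀ q, F (rotMap q) = rotMap (f q)) (hf : Set.MapsTo f S T) :
    RotJoined T (f x) (f y) := by
  have := JoinedIn.map h hF
  rw [hfF, hfF] at this
  refine this.mono ?_
  rintro _ ⟨_, ⟨q, hq, rfl⟩, rfl⟩
  exact ⟨f q, hf hq, (hfF q).symm⟩

end RotJoined

lemma continuousOn_conj {d : ℍ} (hd : ∀ t ∈ unitInterval, 1 + t • d ≠ 0) (q : ℍ) :
    ContinuousOn (fun t : ℝ => (1 + t • d) * q * (1 + t • d)⁻¹) unitInterval := by
  have h : ContinuousOn (fun t : ℝ => 1 + t • d) unitInterval := by fun_prop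
  exact (h.mul continuousOn_const).mul (h.inv₀ hd)

open Classical in
/-- The entries in `T` can be conjugated along a path until one of them, `q i₀`, becomes parallel
to `v`, if the entries outside `T` that have an edge to `T` relate to `q i₀` and `v` alike. -/
lemma exists_rotJoined_conj {E : ι → ι → ℝ → Prop} {C : ι → Set ℍ} {q : ι → ℍ}
    (hq : q ∈ Conf E C) (T : Set ι) {i₀ : ι} (hi₀ : i₀ ∈ T) {v : ℍ} (hv : v ≠ 0) (hv0 : v.re = 0)
    (hq0 : (q i₀).re = 0) (hC : ∀ i ∈ T, ∀ c : ℍ, c ≠ 0 → c * q i * c⁻¹ ∈ C i)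
    (hE : ∀ i j ε, E i j ε → ∀ k, (k = i ∧ j ∈ T ∨ k = j ∧ i ∈ T) → k ∉ T →
      ∃ δ : ℝ, δ * δ = 1 ∧ q k * q i₀ = δ • (q i₀ * q k) ∧ q k * v = δ • (v * q k)) :
    ∃ q' ∈ Conf E C, RotJoined (Conf E C) q q' ∧ Parallel (q' i₀) v ∧ ∀ i ∉ T, q' i = q i := by
  obtain ⟨hne, hmem, hrel⟩ := hq
  obtain ⟨d, hd, hpar, hcomm⟩ := exists_conj_parallel (hne i₀) hv hq0 hv0
  set γ : ℝ → ι → ℍ := fun t i =>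
    if i ∈ T then (1 + t • d) * q i * (1 + t • d)⁻¹ else q i with hγ
  have h0 : ∀ t ∈ unitInterval, ∀ i, γ t i ≠ 0 := by
    intro t ht i
    by_cases hi : i ∈ T
    · simpa only [hγ, hi, if_true] using
        mul_ne_zero (mul_ne_zero (hd t ht) (hne i)) (inv_ne_zero (hd t ht))
    · simpa [hγ, hi] using hne i
  have hconj : ∀ t ∈ unitInterval, ∀ i, Commute (q i) d →
      q i = (1 + t • d) * q i * (1 + t • d)⁻¹ := fun t ht i h =>
    (conj_eq_of_commute (hd t ht) ((Commute.one_right _).add_right (h.smul_right t))).symm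
  have hcr : ∀ i j ε, E i j ε → ∀ k, (k = i ∧ j ∈ T ∨ k = j ∧ i ∈ T) → k ∉ T →
      Commute (q k) d := by
    intro i j ε h k hk hkT
    obtain ⟨δ, h1, h2, h3⟩ := hE i j ε h k hk hkT
    exact hcomm _ δ h1 h2 h3
  have hS : ∀ t ∈ unitInterval, γ t ∈ Conf E C := by
    intro t ht
    refine ⟨h0 t ht, fun i => ?_, fun i j ε h => ?_⟩
    · by_cases hi : i ∈ T
      · simpa [hγ, hi] using hC i hi _ (hd t ht)
      · simpa [hγ, hi] using hmem i
    · have hc := conj_mul_conj (hd t ht) (hrel i j ε h)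
      by_cases hi : i ∈ T <;> by_cases hj : j ∈ T
      · simpa only [hγ, hi, hj, if_true] using hc
      · rw [← hconj t ht j (hcr i j ε h j (Or.inr ⟨rfl, hi⟩) hj)] at hc
        simpa only [hγ, hi, hj, if_true, if_false] using hc
      · rw [← hconj t ht i (hcr i j ε h i (Or.inl ⟨rfl, hj⟩) hi)] at hc
        simpa only [hγ, hi, hj, if_true, if_false] using hc
      · simpa only [hγ, hi, hj, if_false] using hrel i j ε h
  have hq0 : γ 0 = q := by
    funext i
    simp [hγ]
  refine ⟨γ 1, hS 1 ⟨zero_le_one, le_rfl⟩, ?_, by simpa [hγ, hi₀] using hpar,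
    fun i hi => by simp [hγ, hi]⟩
  rw [← hq0]
  refine RotJoined.of_path γ hS h0 fun i => ?_
  by_cases hi : i ∈ T
  · simpa [hγ, hi] using continuousOn_conj hd (q i)
  · simpa [hγ, hi] using continuousOn_const

end Configurations

section Walks

open Quaternion

lemma parallel_of_anticommute {u w p q : ℍ} (huw : ¬ Commute u w) (hp : p ≠ 0) (hq : q ≠ 0)
    (hpu : p * u = (-1 : ℝ) • (u * p)) (hpw : p * w = (-1 : ℝ) • (w * p))
    (hqu : q * u = (-1 : ℝ) • (u * q)) (hqw : q * w = (-1 : ℝ) • (w * q)) : Parallel p q := by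
  have hu : u ≠ 0 := fun h => huw (h ▸ Commute.zero_left w)
  have hD : u * w - w * u ≠ 0 := fun h => huw (sub_eq_zero.1 h)
  have hD0 : (u * w - w * u).re = 0 := by rw [re_sub, Quaternion.re_mul_comm, sub_self]
  have key : ∀ {r : ℍ}, r ≠ 0 → r * u = (-1 : ℝ) • (u * r) → r * w = (-1 : ℝ) • (w * r) →
      Parallel (u * w - w * u) r := fun hr hru hrw =>
    parallel_of_commute hD hr hD0 (re_eq_zero_of_mul_eq_neg hu hru)
      ((commute_mul_of_mul_comm (by norm_num) hrw hru).sub_right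
        (commute_mul_of_mul_comm (by norm_num) hru hrw)).symm
  exact (key hp hpu hpw).symm.trans (key hq hqu hqw)

lemma mul_commutator_eq_neg {p : ℍ} (q : ℍ) (hp : p.re = 0) :
    p * (p * q - q * p) = (-1 : ℝ) • ((p * q - q * p) * p) := by
  have h : p * p * q = q * (p * p) := by
    rw [mul_self_of_re_eq_zero_s2 hp, coe_commutes]
  rw [neg_one_smul, mul_sub, sub_mul, ← mul_assoc, h]
  noncomm_ring

/-- Walks `x 0, …, x m` of successively anticommuting quaternions from the line of `a` back to
itself, continued by `1`. -/
def Walk (m : ℕ) (a : ℍ) : Set (ℕ → ℍ) :=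
  Conf (fun i j ε => i < m ∧ j = i + 1 ∧ ε = -1)
    (fun k => {q | (k = 0 ∨ k = m → Parallel a q) ∧ (m < k → q = 1)})

namespace Walk

variable {m : ℕ} {a : ℍ} {x y : ℕ → ℍ}

lemma ne_zero (hx : x ∈ Walk m a) (k : ℕ) : x k ≠ 0 := hx.1 k

lemma parallel_zero (hx : x ∈ Walk m a) : Parallel a (x 0) := (hx.2.1 0).1 (Or.inl rfl)

lemma parallel_last (hx : x ∈ Walk m a) : Parallel a (x m) := (hx.2.1 m).1 (Or.inr rfl)

lemma eq_one (hx : x ∈ Walk m a) {k : ℕ} (hk : m < k) : x k = 1 := (hx.2.1 k).2 hk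

lemma anticommute (hx : x ∈ Walk m a) {k : ℕ} (hk : k < m) :
    x k * x (k + 1) = (-1 : ℝ) • (x (k + 1) * x k) := hx.2.2 k (k + 1) _ ⟨hk, rfl, rfl⟩

lemma mk (hne : ∀ k, x k ≠ 0) (h0 : Parallel a (x 0)) (hm : Parallel a (x m))
    (h1 : ∀ k, m < k → x k = 1)
    (h : ∀ k < m, x k * x (k + 1) = (-1 : ℝ) • (x (k + 1) * x k)) : x ∈ Walk m a := by
  refine ⟨hne, fun k => ⟨?_, h1 k⟩, ?_⟩
  · rintro (rfl | rfl) <;> assumption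
  · rintro i j ε ⟨hi, rfl, rfl⟩
    exact h i hi

lemma re_eq_zero (hx : x ∈ Walk m a) (hm : 0 < m) {k : ℕ} (hk : k ≤ m) : (x k).re = 0 := by
  rcases hk.lt_or_eq with h | rfl
  · exact re_eq_zero_of_mul_eq_neg (ne_zero hx (k + 1)) (anticommute hx h)
  · obtain ⟨l, rfl⟩ := Nat.exists_eq_succ_of_ne_zero hm.ne'
    exact re_eq_zero_of_mul_eq_neg (ne_zero hx l)
      (mul_eq_neg_smul_symm (anticommute hx l.lt_succ_self))

/-- An entry between two parallel ones can be replaced by any quaternion anticommuting with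
them. -/
lemma exists_replace (hx : x ∈ Walk m a) {i : ℕ} (hi : i + 2 ≤ m)
    (hpar : Parallel (x i) (x (i + 2))) {v : ℍ} (hv : v ≠ 0)
    (h : x i * v = (-1 : ℝ) • (v * x i)) :
    ∃ x' ∈ Walk m a, RotJoined (Walk m a) x x' ∧ Parallel (x' (i + 1)) v ∧
      ∀ j, j ≠ i + 1 → x' j = x j := by
  have hi1 := anticommute hx (show i < m by omega)
  refine exists_rotJoined_conj hx {i + 1} rfl hv
    (re_eq_zero_of_mul_eq_neg (ne_zero hx i) (mul_eq_neg_smul_symm h))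
    (re_eq_zero hx (by omega) (by omega)) ?_ ?_
  · rintro _ rfl c -
    exact ⟨by omega, by omega⟩
  · rintro j _ ε ⟨hj, rfl, rfl⟩ k hk hk'
    refine ⟨-1, by norm_num, ?_⟩
    rcases hk with ⟨rfl, h'⟩ | ⟨rfl, h'⟩
    · obtain rfl : k = i := by simpa using h'
      exact ⟨hi1, h⟩
    · obtain rfl : j = i + 1 := h'
      exact ⟨hpar.mul_comm_left hi1, hpar.mul_comm_left h⟩

/-- A walk of length at least four can be deformed so as to return to its starting line after
two steps. -/
lemma exists_parallel_two (ha : a ≠ 0) (hx : x ∈ Walk m a) (hm : 4 ≤ m) :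
    ∃ x' ∈ Walk m a, RotJoined (Walk m a) x x' ∧ Parallel a (x' 2) := by
  have h01 := anticommute hx (show 0 < m by omega)
  have h12 := anticommute hx (show 1 < m by omega)
  have h23 := anticommute hx (show 2 < m by omega)
  have h34 := anticommute hx (show 3 < m by omega)
  simp only [zero_add, Nat.reduceAdd] at h01 h12 h23 h34
  have hre {k : ℕ} (hk : k ≤ m) := re_eq_zero hx (by omega) hk
  have ha1 : x 1 * a = (-1 : ℝ) • (a * x 1) :=
    (parallel_zero hx).symm.mul_comm_right (mul_eq_neg_smul_symm h01)
  have hare : a.re = 0 := re_eq_zero_of_mul_eq_neg (ne_zero hx 1) (mul_eq_neg_smul_symm ha1)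
  have finish {y : ℕ → ℍ} (hy : y ∈ Walk m a) (hxy : RotJoined (Walk m a) x y)
      (hy1 : y 1 = x 1) (hp : Parallel (y 1) (y 3)) :
      ∃ x' ∈ Walk m a, RotJoined (Walk m a) x x' ∧ Parallel a (x' 2) := by
    obtain ⟨z, hz, hyz, hz2, -⟩ := exists_replace hy (i := 1) (by omega) hp ha (by rwa [hy1])
    exact ⟨z, hz, hxy.trans hyz, hz2.symm⟩
  by_cases h24 : Commute (x 2) (x 4)
  · obtain ⟨y, hy, hxy, hy3, hyx⟩ := exists_replace hx (i := 2) (by omega)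
      (parallel_of_commute (ne_zero hx 2) (ne_zero hx 4) (hre (by omega)) (hre (by omega)) h24)
      (ne_zero hx 1) (mul_eq_neg_smul_symm h12)
    have hy1 := hyx 1 (by omega)
    exact finish hy hxy hy1 (hy1 ▸ hy3.symm)
  by_cases h14 : x 1 * x 4 = (-1 : ℝ) • (x 4 * x 1)
  · exact finish hx (RotJoined.refl hx) rfl (parallel_of_anticommute h24 (ne_zero hx 1)
      (ne_zero hx 3) h12 h14 (mul_eq_neg_smul_symm h23) h34)
  obtain ⟨d, hd, hpar, hcomm⟩ :=
    exists_conj_parallel (ne_zero hx 2) ha (hre (by omega)) hare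
  have hd1 : Commute (x 1) d := hcomm _ (-1) (by norm_num) h12 ha1
  set u : ℝ → ℍ := fun t => (1 + t • d) * x 2 * (1 + t • d)⁻¹ with hu
  have hu0 : u 0 = x 2 := by simp [hu]
  have hune : ∀ t ∈ unitInterval, u t ≠ 0 := fun t ht =>
    mul_ne_zero (mul_ne_zero (hd t ht) (ne_zero hx 2)) (inv_ne_zero (hd t ht))
  have hu1 : ∀ t ∈ unitInterval, x 1 * u t = (-1 : ℝ) • (u t * x 1) := by
    intro t ht
    have := conj_mul_conj (hd t ht) h12
    rwa [conj_eq_of_commute (hd t ht)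
      ((Commute.one_right _).add_right (hd1.smul_right t))] at this
  have hure : ∀ t ∈ unitInterval, (u t).re = 0 := fun t ht =>
    re_eq_zero_of_mul_eq_neg (ne_zero hx 1) (mul_eq_neg_smul_symm (hu1 t ht))
  have hu4 : ∀ t ∈ unitInterval, ¬ Commute (u t) (x 4) := fun t ht h =>
    h14 ((parallel_of_commute (hune t ht) (ne_zero hx 4) (hure t ht) (hre (by omega))
      h).mul_comm_right (hu1 t ht))
  set D : ℝ → ℍ := fun t => u t * x 4 - x 4 * u t with hD
  have hDne : ∀ t ∈ unitInterval, D t ≠ 0 := fun t ht h => hu4 t ht (sub_eq_zero.1 h)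
  have huD : ∀ t ∈ unitInterval, u t * D t = (-1 : ℝ) • (D t * u t) := fun t ht =>
    mul_commutator_eq_neg _ (hure t ht)
  have hD4 : ∀ t, D t * x 4 = (-1 : ℝ) • (x 4 * D t) := by
    intro t
    have := mul_commutator_eq_neg (u t) (hre (show 4 ≤ m by omega))
    rw [← neg_sub (u t * x 4), mul_neg, neg_mul, smul_neg, neg_inj] at this
    exact mul_eq_neg_smul_symm this
  set γ : ℝ → ℕ → ℍ := fun t => Function.update (Function.update x 2 (u t)) 3 (D t) with hγ
  have g2 (t) : γ t 2 = u t := by simp [hγ]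
  have g3 (t) : γ t 3 = D t := by simp [hγ]
  have gk (t) {k : ℕ} (h2 : k ≠ 2) (h3 : k ≠ 3) : γ t k = x k := by simp [hγ, h2, h3]
  have h0 : ∀ t ∈ unitInterval, ∀ k, γ t k ≠ 0 := by
    intro t ht k
    by_cases h2 : k = 2
    · rw [h2, g2]; exact hune t ht
    by_cases h3 : k = 3
    · rw [h3, g3]; exact hDne t ht
    rw [gk t h2 h3]; exact ne_zero hx k
  have hS : ∀ t ∈ unitInterval, γ t ∈ Walk m a := by
    intro t ht
    refine mk (h0 t ht) ?_ ?_ (fun k hk => ?_) (fun k hk => ?_)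
    · rw [gk t (by omega) (by omega)]; exact parallel_zero hx
    · rw [gk t (by omega) (by omega)]; exact parallel_last hx
    · rw [gk t (by omega) (by omega)]; exact eq_one hx hk
    · by_cases k1 : k = 1
      · subst k1; rw [g2, gk t (by omega) (by omega)]; exact hu1 t ht
      by_cases k2 : k = 2
      · subst k2; rw [g2, g3]; exact huD t ht
      by_cases k3 : k = 3
      · subst k3; rw [g3, gk t (by omega) (by omega)]; exact hD4 t
      rw [gk t k2 k3, gk t (by omega) (by omega)]; exact anticommute hx hk
  have hx3 : Parallel (x 3) (D 0) :=
    parallel_of_anticommute h24 (ne_zero hx 3) (hDne 0 ⟨le_rfl, zero_le_one⟩)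
      (mul_eq_neg_smul_symm h23) h34
      (by
        have := huD 0 ⟨le_rfl, zero_le_one⟩
        rw [hu0] at this
        exact mul_eq_neg_smul_symm this) (hD4 0)
  refine ⟨γ 1, hS 1 ⟨zero_le_one, le_rfl⟩,
    (RotJoined.of_parallel hx fun k => ?_).trans (RotJoined.of_path γ hS h0 fun k => ?_), ?_⟩
  · by_cases h2 : k = 2
    · rw [h2, g2, hu0]; exact Parallel.refl _
    by_cases h3 : k = 3
    · rw [h3, g3]; exact hx3
    rw [gk 0 h2 h3]; exact Parallel.refl _
  · have huc : ContinuousOn u unitInterval := continuousOn_conj hd (x 2)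
    by_cases h2 : k = 2
    · subst h2; simpa only [g2] using huc
    by_cases h3 : k = 3
    · subst h3
      simp only [g3]
      exact (huc.mul continuousOn_const).sub (continuousOn_const.mul huc)
    simpa only [gk _ h2 h3] using continuousOn_const
  · rw [g2, hu]
    simpa using hpar.symm

end Walk
end Walks

section WalksJoined

open Quaternion

lemma eq_zero_of_eq_neg_one_smul {q : ℍ} (h : q = (-1 : ℝ) • q) : q = 0 := by
  rw [← sub_eq_zero, ← one_smul ℝ q, smul_smul, ← sub_smul] at h
  exact (smul_eq_zero.1 h).resolve_left (by norm_num)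

/-- Prepend two entries to a sequence. -/
def consTwo {α : Type*} (a b : α) (x : ℕ → α) : ℕ → α
  | 0 => a
  | 1 => b
  | k + 2 => x k

namespace Walk

variable {m : ℕ} {a v : ℍ} {x y : ℕ → ℍ}

lemma consTwo_mem (ha : a ≠ 0) (hv : v ≠ 0) (hav : a * v = (-1 : ℝ) • (v * a))
    (hx : x ∈ Walk m a) : consTwo a v x ∈ Walk (m + 2) a := by
  refine mk (fun k => ?_) (Parallel.refl a) (x := consTwo a v x)
    (show Parallel a (x m) from parallel_last hx) (fun k hk => ?_) (fun k hk => ?_)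
  · match k with
    | 0 => exact ha
    | 1 => exact hv
    | k + 2 => exact ne_zero hx k
  · match k, hk with
    | k + 2, hk => exact eq_one hx (by omega)
  · match k, hk with
    | 0, _ => exact hav
    | 1, _ => exact (parallel_zero hx).mul_comm_right (mul_eq_neg_smul_symm hav)
    | k + 2, hk => exact anticommute hx (by omega)

lemma drop_two_mem (hx : x ∈ Walk (m + 2) a) (h2 : Parallel a (x 2)) :
    (fun k => x (k + 2)) ∈ Walk m a :=
  mk (fun k => ne_zero hx _) h2 (parallel_last hx) (fun k hk => eq_one hx (by omega))
    (fun k hk => anticommute hx (by omega))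

lemma parallel_consTwo (h0 : Parallel a (x 0)) (h1 : Parallel v (x 1)) (k : ℕ) :
    Parallel (consTwo a v (fun k => x (k + 2)) k) (x k) := by
  match k with
  | 0 => exact h0
  | 1 => exact h1
  | k + 2 => exact Parallel.refl _

lemma rotJoined_consTwo (ha : a ≠ 0) (hv : v ≠ 0) (hav : a * v = (-1 : ℝ) • (v * a))
    (h : RotJoined (Walk m a) x y) :
    RotJoined (Walk (m + 2) a) (consTwo a v x) (consTwo a v y) := by
  refine h.map (consTwo a v) (consTwo (rot a) (rot v)) (continuous_pi fun k => ?_)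
    (fun q => funext fun k => ?_) fun x hx => consTwo_mem ha hv hav hx
  · match k with
    | 0 => exact continuous_const
    | 1 => exact continuous_const
    | k + 2 => exact continuous_apply k
  · match k with
    | 0 => rfl
    | 1 => rfl
    | k + 2 => rfl

lemma rotJoined_of_three (ha : a ≠ 0) (hx : x ∈ Walk 3 a) (hy : y ∈ Walk 3 a) :
    RotJoined (Walk 3 a) x y := by
  have hx01 : a * x 1 = (-1 : ℝ) • (x 1 * a) :=
    (parallel_zero hx).symm.mul_comm_left (anticommute hx (show 0 < 3 by omega))
  have hy01 : a * y 1 = (-1 : ℝ) • (y 1 * a) :=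
    (parallel_zero hy).symm.mul_comm_left (anticommute hy (show 0 < 3 by omega))
  obtain ⟨z, hz, hxz, hz1, hzx⟩ := exists_rotJoined_conj hx {1, 2} (i₀ := 1) (by simp)
    (ne_zero hy 1) (re_eq_zero hy (by omega) (by omega)) (re_eq_zero hx (by omega) (by omega))
    (by
      rintro i (rfl | rfl) c -
      · exact ⟨by omega, by omega⟩
      · exact ⟨by omega, by omega⟩)
    (by
      rintro i _ ε ⟨hi, rfl, rfl⟩ k hk hkT
      have hak : Parallel a (x k) := by
        have : k = 0 ∨ k = 3 := by
          simp only [Set.mem_insert_iff, Set.mem_singleton_iff] at hk hkT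
          omega
        exact (hx.2.1 k).1 this
      exact ⟨-1, by norm_num, hak.mul_comm_left hx01, hak.mul_comm_left hy01⟩)
  refine hxz.trans (RotJoined.of_parallel hz fun k => ?_)
  have two {w : ℕ → ℍ} (hw : w ∈ Walk 3 a) : w 2 * a = (-1 : ℝ) • (a * w 2) :=
    (parallel_last hw).symm.mul_comm_right (anticommute hw (show 2 < 3 by omega))
  match k with
  | 0 => exact (parallel_zero hz).symm.trans (parallel_zero hy)
  | 1 => exact hz1
  | 2 =>
    refine parallel_of_anticommute (u := a) (w := y 1) (fun h => ?_) (ne_zero hz 2) (ne_zero hy 2)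
      (two hz) ?_ (two hy) (mul_eq_neg_smul_symm (anticommute hy (show 1 < 3 by omega)))
    · rw [h.eq] at hy01
      exact mul_ne_zero (ne_zero hy 1) ha (eq_zero_of_eq_neg_one_smul hy01)
    · exact hz1.mul_comm_right (mul_eq_neg_smul_symm (anticommute hz (show 1 < 3 by omega)))
  | 3 => exact (parallel_last hz).symm.trans (parallel_last hy)
  | k + 4 => rw [eq_one hz (by omega), eq_one hy (by omega)]; exact Parallel.refl 1

/-- Any two walks of the same length are joined. -/
theorem rotJoined (ha : a ≠ 0) : ∀ {m : ℕ} {x y : ℕ → ℍ}, x ∈ Walk m a → y ∈ Walk m a →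
    RotJoined (Walk m a) x y
  | 0, x, y, hx, hy => RotJoined.of_parallel hx fun k => by
      rcases k.eq_zero_or_pos with rfl | hk
      · exact (parallel_zero hx).symm.trans (parallel_zero hy)
      · rw [eq_one hx hk, eq_one hy hk]; exact Parallel.refl 1
  | 1, x, y, hx, hy => by
      have h := (parallel_last hx).symm.mul_comm_right
        ((parallel_zero hx).symm.mul_comm_left (anticommute hx zero_lt_one))
      exact absurd (eq_zero_of_eq_neg_one_smul h) (mul_ne_zero ha ha)
  | 3, x, y, hx, hy => rotJoined_of_three ha hx hy
  | m + 2, x, y, hx, hy => by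
      by_cases hm : m = 1
      · subst hm; exact rotJoined_of_three ha hx hy
      have reduce {w : ℕ → ℍ} (hw : w ∈ Walk (m + 2) a) :
          ∃ w' ∈ Walk (m + 2) a, RotJoined (Walk (m + 2) a) w w' ∧ Parallel a (w' 2) := by
        rcases m.eq_zero_or_pos with rfl | hm0
        · exact ⟨w, hw, RotJoined.refl hw, parallel_last hw⟩
        · exact exists_parallel_two ha hw (by omega)
      obtain ⟨x', hx', hxx', hx2⟩ := reduce hx
      obtain ⟨y', hy', hyy', hy2⟩ := reduce hy
      have hy01 := anticommute hy' (show 0 < m + 2 by omega)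
      have hav : a * y' 1 = (-1 : ℝ) • (y' 1 * a) := (parallel_zero hy').symm.mul_comm_left hy01
      obtain ⟨z, hz, hxz, hz1, hzx⟩ := exists_replace (i := 0) hx' (by omega)
        ((parallel_zero hx').symm.trans hx2) (ne_zero hy' 1)
        ((parallel_zero hx').mul_comm_left hav)
      have hz2 : Parallel a (z 2) := by rw [hzx 2 (by omega)]; exact hx2
      have hj := rotJoined_consTwo ha (ne_zero hy' 1) hav
        (rotJoined ha (drop_two_mem hz hz2) (drop_two_mem hy' hy2))
      have hzp := parallel_consTwo (parallel_zero hz) hz1.symm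
      have hyp := parallel_consTwo (parallel_zero hy') (Parallel.refl (y' 1))
      exact (hxx'.trans hxz).trans ((RotJoined.of_parallel hz fun k => (hzp k).symm).trans
        (hj.trans ((RotJoined.of_parallel hy' fun k => (hyp k).symm).symm.trans hyy'.symm)))

end Walk
end WalksJoined

section Contraction

open Quaternion

/-- Contracting the parallel steps of a sequence of quaternions. -/
lemma exists_contraction {x : ℕ → ℍ} (hne : ∀ k, x k ≠ 0) (p : ℕ → Prop) [DecidablePred p]
    (h1 : ∀ k, p k → x k * x (k + 1) = (-1 : ℝ) • (x (k + 1) * x k))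
    (h2 : ∀ k, ¬ p k → Parallel (x k) (x (k + 1))) (n : ℕ) :
    ∃ l : ℕ → ℍ, (∀ k, l k ≠ 0) ∧ l 0 = x 0 ∧
      (∀ k ≤ n, Parallel (l (Nat.count p k)) (x k)) ∧
      (∀ k < Nat.count p n, l k * l (k + 1) = (-1 : ℝ) • (l (k + 1) * l k)) ∧
      ∀ k, Nat.count p n < k → l k = 1 := by
  induction n with
  | zero =>
    refine ⟨fun k => if k = 0 then x 0 else 1, fun k => ?_, rfl, fun k hk => ?_, ?_, ?_⟩
    · beta_reduce
      split_ifs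
      exacts [hne 0, one_ne_zero]
    · obtain rfl : k = 0 := by omega
      simpa using Parallel.refl (x 0)
    · simp
    · intro k hk
      rw [Nat.count_zero] at hk
      simp [hk.ne']
  | succ n ih =>
    obtain ⟨l, hl, hl0, hlp, hla, hl1⟩ := ih
    by_cases hp : p n
    · have hc : Nat.count p (n + 1) = Nat.count p n + 1 := by simp [Nat.count_succ, hp]
      have hup {k : ℕ} (hk : k ≤ Nat.count p n) :
          Function.update l (Nat.count p n + 1) (x (n + 1)) k = l k :=
        Function.update_of_ne (by omega) _ _
      refine ⟨Function.update l (Nat.count p n + 1) (x (n + 1)), fun k => ?_, ?_,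
        fun k hk => ?_, fun k hk => ?_, fun k hk => ?_⟩
      · by_cases hk : k = Nat.count p n + 1
        · rw [hk, Function.update_self]; exact hne _
        · rw [Function.update_of_ne hk]; exact hl k
      · rw [hup (Nat.zero_le _), hl0]
      · rcases hk.lt_or_eq with hk | rfl
        · rw [hup (Nat.count_monotone p (Nat.lt_succ_iff.1 hk))]
          exact hlp k (by omega)
        · rw [hc, Function.update_self]; exact Parallel.refl _
      · rw [hc] at hk
        rcases (Nat.lt_succ_iff.1 hk).lt_or_eq with hk | rfl
        · rw [hup hk.le, hup hk]; exact hla k hk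
        · rw [hup le_rfl, Function.update_self]
          exact (hlp n le_rfl).symm.mul_comm_left (h1 n hp)
      · rw [hc] at hk
        rw [Function.update_of_ne (by omega)]
        exact hl1 k (by omega)
    · have hc : Nat.count p (n + 1) = Nat.count p n := by simp [Nat.count_succ, hp]
      refine ⟨l, hl, hl0, fun k hk => ?_, by rwa [hc], by rwa [hc]⟩
      rcases hk.lt_or_eq with hk | rfl
      · exact hlp k (by omega)
      · rw [hc]; exact (hlp n le_rfl).trans (h2 n hp)

end Contraction

section Cycles

open Quaternion

variable {m : ℕ}

/-- Cyclic families of nonzero quaternions in which `q i` and `q (i + 1)` anticommute if `e i` and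
commute otherwise. -/
def Cyc (e : Fin (m + 1) → Bool) (C : Fin (m + 1) → Set ℍ) : Set (Fin (m + 1) → ℍ) :=
  Conf (fun i j ε => j = i + 1 ∧ ε = if e i then -1 else 1) C

/-- The vertex `i` has no anticommuting edge. -/
def Free (e : Fin (m + 1) → Bool) (i : Fin (m + 1)) : Prop := ∀ j, j = i ∨ j + 1 = i → e j = false

/-- The constraint that free vertices carry `1`. -/
def freeOne (e : Fin (m + 1) → Bool) (i : Fin (m + 1)) : Set ℍ := {q | Free e i → q = 1}

namespace Cyc

variable {e : Fin (m + 1) → Bool} {C : Fin (m + 1) → Set ℍ} {x y : Fin (m + 1) → ℍ}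

lemma rel (hx : x ∈ Cyc e C) (i : Fin (m + 1)) :
    x i * x (i + 1) = (if e i then -1 else 1 : ℝ) • (x (i + 1) * x i) :=
  hx.2.2 i (i + 1) _ ⟨rfl, rfl⟩

lemma mk (hne : ∀ i, x i ≠ 0) (hC : ∀ i, x i ∈ C i)
    (h : ∀ i, x i * x (i + 1) = (if e i then -1 else 1 : ℝ) • (x (i + 1) * x i)) : x ∈ Cyc e C := by
  refine ⟨hne, hC, ?_⟩
  rintro i j ε ⟨rfl, rfl⟩
  exact h i

lemma subset_univ : Cyc e C ⊆ Cyc e fun _ => Set.univ :=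
  fun _ hx => mk hx.1 (fun _ => Set.mem_univ _) (rel hx)

lemma anticommute (hx : x ∈ Cyc e C) {i : Fin (m + 1)} (hi : e i = true) :
    x i * x (i + 1) = (-1 : ℝ) • (x (i + 1) * x i) := by
  simpa [hi] using rel hx i

lemma commute (hx : x ∈ Cyc e C) {i : Fin (m + 1)} (hi : e i = false) :
    Commute (x i) (x (i + 1)) := by
  show x i * x (i + 1) = x (i + 1) * x i
  simpa [hi] using rel hx i

lemma re_eq_zero (hx : x ∈ Cyc e C) {i : Fin (m + 1)} (hi : ¬ Free e i) : (x i).re = 0 := by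
  simp only [Free, not_forall, Bool.not_eq_false] at hi
  obtain ⟨j, rfl | rfl, hj⟩ := hi
  · exact re_eq_zero_of_mul_eq_neg (hx.1 _) (anticommute hx hj)
  · exact re_eq_zero_of_mul_eq_neg (hx.1 _) (mul_eq_neg_smul_symm (anticommute hx hj))

lemma sign_mul_self (e : Fin (m + 1) → Bool) (i : Fin (m + 1)) :
    (if e i then -1 else 1 : ℝ) * (if e i then -1 else 1) = 1 := by
  split_ifs <;> norm_num

open Classical in
lemma exists_freeOne (hx : x ∈ Cyc e fun _ => Set.univ) :
    ∃ y ∈ Cyc e (freeOne e), RotJoined (Cyc e fun _ => Set.univ) x y := by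
  set q : Fin (m + 1) → ℍ := fun i => (if (x i).re < 0 then -1 else 1 : ℝ) • x i with hq
  have hpar : ∀ i, Parallel (x i) (q i) := fun i => ⟨_, by split_ifs <;> norm_num, rfl⟩
  have hqne : ∀ i, q i ≠ 0 := fun i => (hpar i).ne_zero (hx.1 i)
  have hqre : ∀ i, 0 ≤ (q i).re := by
    intro i
    rw [hq, re_smul, smul_eq_mul]
    split_ifs with h <;> linarith
  have hqrel : ∀ i, q i * q (i + 1) = (if e i then -1 else 1 : ℝ) • (q (i + 1) * q i) := fun i =>
    (hpar i).mul_comm_left ((hpar (i + 1)).mul_comm_right (rel hx i))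
  set γ : ℝ → Fin (m + 1) → ℍ :=
    fun t i => if Free e i then (1 - t) • q i + t • (1 : ℍ) else q i with hγ
  have h0 : ∀ t ∈ unitInterval, ∀ i, γ t i ≠ 0 := by
    intro t ht i
    by_cases hi : Free e i
    · simp only [hγ, hi, if_true]
      intro h
      have hre := congrArg QuaternionAlgebra.re h
      simp only [re_add, re_smul, re_one, smul_eq_mul, mul_one, re_zero] at hre
      have ht0 : t = 0 := by
        nlinarith [mul_nonneg (sub_nonneg.2 ht.2) (hqre i), ht.1]
      exact hqne i (by simpa [ht0] using h)
    · simpa only [hγ, hi, if_false] using hqne i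
  have hrel : ∀ t i, γ t i * γ t (i + 1) =
      (if e i then -1 else 1 : ℝ) • (γ t (i + 1) * γ t i) := by
    intro t i
    by_cases hi : e i = true
    · have h1 : ¬ Free e i := fun h => by simp [h i (Or.inl rfl)] at hi
      have h2 : ¬ Free e (i + 1) := fun h => by simp [h i (Or.inr rfl)] at hi
      simpa only [hγ, h1, h2, if_false] using hqrel i
    · have hc : Commute (q i) (q (i + 1)) := by
        show q i * q (i + 1) = q (i + 1) * q i
        simpa [hi] using hqrel i
      have hz : ∀ w z : ℍ, Commute w z → Commute w ((1 - t) • z + t • (1 : ℍ)) := fun w z h =>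
        (h.smul_right _).add_right ((Commute.one_right w).smul_right t)
      have : Commute (γ t i) (γ t (i + 1)) := by
        by_cases h1 : Free e i <;> by_cases h2 : Free e (i + 1) <;>
          simp only [hγ, h1, h2, if_true, if_false]
        · exact hz _ _ (hz _ _ hc.symm).symm
        · exact (hz _ _ hc.symm).symm
        · exact hz _ _ hc
        · exact hc
      simpa [hi] using this.eq
  refine ⟨γ 1, mk (h0 1 ⟨zero_le_one, le_rfl⟩) (fun i hi => by simp [hγ, hi]) (hrel 1),
    (RotJoined.of_parallel hx fun i => ?_).trans (RotJoined.of_path γ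
      (fun t ht => mk (h0 t ht) (fun _ => Set.mem_univ _) (hrel t)) h0 fun i => ?_)⟩
  · simpa [hγ] using hpar i
  · by_cases hi : Free e i
    · simp only [hγ, hi, if_true]
      fun_prop
    · simpa only [hγ, hi, if_false] using continuousOn_const

lemma val_succ_sub (i j : Fin (m + 1)) :
    (i + 1 - j).val = if (i - j).val = m then 0 else (i - j).val + 1 := by
  have : i + 1 - j = i - j + 1 := by abel
  rw [this, Fin.val_add_one]
  simp [Fin.ext_iff]

/-- Two families are joined if some vertex is free. -/
lemma rotJoined_of_free {i₀ : Fin (m + 1)} (hi₀ : Free e i₀) (hx : x ∈ Cyc e (freeOne e))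
    (hy : y ∈ Cyc e (freeOne e)) : RotJoined (Cyc e (freeOne e)) x y := by
  have key : ∀ k ≤ m, ∃ z ∈ Cyc e (freeOne e), RotJoined (Cyc e (freeOne e)) x z ∧
      ∀ i, (i - i₀).val ≤ k → Parallel (z i) (y i) := by
    intro k
    induction k with
    | zero =>
      refine fun _ => ⟨x, hx, RotJoined.refl hx, fun i hi => ?_⟩
      have : i - i₀ = 0 := Fin.ext (by simpa using hi)
      obtain rfl := sub_eq_zero.1 this
      rw [hx.2.1 i hi₀, hy.2.1 i hi₀]
      exact Parallel.refl 1
    | succ k ih =>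
      intro hk
      obtain ⟨z, hz, hxz, hzy⟩ := ih (by omega)
      set i₁ : Fin (m + 1) := i₀ + ⟨k + 1, by omega⟩ with hi₁
      have hpos : (i₁ - i₀).val = k + 1 := by rw [hi₁, add_sub_cancel_left]
      have huniq : ∀ i, (i - i₀).val = k + 1 → i = i₁ := fun i hi =>
        sub_left_injective (Fin.ext (hi.trans hpos.symm))
      by_cases hf : Free e i₁
      · refine ⟨z, hz, hxz, fun i hi => ?_⟩
        rcases hi.lt_or_eq with hi | hi
        · exact hzy i (by omega)
        · obtain rfl := huniq i hi
          rw [hz.2.1 _ hf, hy.2.1 _ hf]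
          exact Parallel.refl 1
      obtain ⟨z', hz', hzz', hz'y, hz'z⟩ := exists_rotJoined_conj hz {i | k + 1 ≤ (i - i₀).val}
        (i₀ := i₁) (v := y i₁) hpos.ge (hy.1 i₁) (re_eq_zero hy hf) (re_eq_zero hz hf)
        (fun i _ c hc hi => by rw [hz.2.1 i hi, mul_one, mul_inv_cancel₀ hc])
        (by
          rintro i _ ε ⟨rfl, rfl⟩ j hj hjT
          simp only [Set.mem_ofPred_eq, not_le] at hj hjT
          have hs := val_succ_sub i i₀
          rcases hj with ⟨rfl, hj⟩ | ⟨rfl, hj⟩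
          · have h1 : j + 1 = i₁ := huniq _ (by split_ifs at hs <;> omega)
            refine ⟨_, sign_mul_self e j, h1 ▸ rel hz j, ?_⟩
            exact (hzy j (by omega)).symm.mul_comm_left (h1 ▸ rel hy j)
          · have h1 : i + 1 - i₀ = 0 := by
              apply Fin.ext
              rw [Fin.val_zero]
              split_ifs at hs <;> omega
            rw [sub_eq_zero.1 h1, hz.2.1 _ hi₀]
            exact ⟨1, by norm_num, by simp, by simp⟩)
      refine ⟨z', hz', hxz.trans hzz', fun i hi => ?_⟩
      rcases hi.lt_or_eq with hi | hi
      · rw [hz'z i (by simpa using hi)]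
        exact hzy i (by omega)
      · obtain rfl := huniq i hi
        exact hz'y
  obtain ⟨z, hz, hxz, hzy⟩ := key m le_rfl
  exact hxz.trans (RotJoined.of_parallel hz fun i => hzy i (by omega))

end Cyc
end Cycles

section CyclesJoined

open Quaternion

namespace Cyc

variable {m : ℕ} {e : Fin (m + 1) → Bool} {C : Fin (m + 1) → Set ℍ} {x y : Fin (m + 1) → ℍ}

lemma ofNat_succ (k : ℕ) : Fin.ofNat (m + 1) (k + 1) = Fin.ofNat (m + 1) k + 1 := by
  ext
  simp [Fin.val_add, Fin.ofNat]

lemma ofNat_val (i : Fin (m + 1)) : Fin.ofNat (m + 1) i.val = i := by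
  ext
  simp [Fin.ofNat, Nat.mod_eq_of_lt i.2]

lemma ofNat_self : Fin.ofNat (m + 1) (m + 1) = 0 := by
  ext
  simp [Fin.ofNat]

/-- The number of anticommuting edges before the vertex `k`. -/
def steps (e : Fin (m + 1) → Bool) (k : ℕ) : ℕ :=
  Nat.count (fun j => e (Fin.ofNat (m + 1) j) = true) k

lemma steps_succ (i : Fin (m + 1)) :
    steps e (i.val + 1) = steps e i.val + if e i then 1 else 0 := by
  rw [steps, Nat.count_succ, ofNat_val, steps]

lemma steps_le (i : Fin (m + 1)) : steps e (i.val + 1) ≤ steps e (m + 1) :=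
  Nat.count_monotone _ i.2

/-- If no vertex is free, a family comes from a walk by repeating entries. -/
lemma exists_walk (hx : x ∈ Cyc e C) (he : ∀ i, ¬ Free e i) :
    ∃ l ∈ Walk (steps e (m + 1)) (x 0), ∀ i, Parallel (l (steps e i.val)) (x i) := by
  obtain ⟨l, hl, hl0, hlp, hla, hl1⟩ := exists_contraction
    (x := fun k => x (Fin.ofNat (m + 1) k)) (fun k => hx.1 _)
    (fun j => e (Fin.ofNat (m + 1) j) = true)
    (fun k hk => by
      rw [ofNat_succ]
      exact anticommute hx hk)
    (fun k hk => by
      rw [ofNat_succ]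
      exact parallel_of_commute (hx.1 _) (hx.1 _) (re_eq_zero hx (he _)) (re_eq_zero hx (he _))
        (commute hx (by simpa using hk))) (m + 1)
  refine ⟨l, Walk.mk hl ?_ ?_ hl1 hla, fun i => ?_⟩
  · rw [hl0]
    exact Parallel.refl _
  · have := hlp (m + 1) le_rfl
    rw [ofNat_self] at this
    exact this.symm
  · have := hlp i.val i.2.le
    rwa [ofNat_val] at this

lemma of_walk {a : ℍ} {l : ℕ → ℍ} (hl : l ∈ Walk (steps e (m + 1)) a) :
    (fun i : Fin (m + 1) => l (steps e i.val)) ∈ Cyc e fun _ => Set.univ := by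
  refine mk (fun i => Walk.ne_zero hl _) (fun _ => Set.mem_univ _) fun i => ?_
  have hpar : Parallel (l (steps e (i.val + 1))) (l (steps e (i + 1).val)) := by
    rw [Fin.val_add_one]
    split_ifs with h
    · subst h
      exact (Walk.parallel_last hl).symm.trans (Walk.parallel_zero hl)
    · exact Parallel.refl _
  refine hpar.mul_comm_right ?_
  have hs := steps_succ (e := e) i
  have hle := steps_le (e := e) i
  rw [hs] at hle ⊢
  cases hi : e i
  · simp
  · simp only [hi, if_true] at hle ⊢
    exact Walk.anticommute hl hle

lemma rotJoined_of_forall_not_free (he : ∀ i, ¬ Free e i) (hx : x ∈ Cyc e fun _ => Set.univ)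
    (hy : y ∈ Cyc e fun _ => Set.univ) : RotJoined (Cyc e fun _ => Set.univ) x y := by
  obtain ⟨z, hz, hxz, hz0, -⟩ := exists_rotJoined_conj hx Set.univ (Set.mem_univ 0) (hy.1 0)
    (re_eq_zero hy (he 0)) (re_eq_zero hx (he 0)) (fun _ _ _ _ => Set.mem_univ _)
    (fun _ _ _ _ k _ hk => absurd (Set.mem_univ k) hk)
  obtain ⟨l, hl, hlz⟩ := exists_walk hz he
  obtain ⟨l', hl', hly⟩ := exists_walk hy he
  have hl2 : l ∈ Walk (steps e (m + 1)) (y 0) :=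
    Walk.mk (Walk.ne_zero hl) (hz0.symm.trans (Walk.parallel_zero hl))
      (hz0.symm.trans (Walk.parallel_last hl)) (fun _ => Walk.eq_one hl)
      (fun _ => Walk.anticommute hl)
  have hj := (Walk.rotJoined (hy.1 0) hl2 hl').map (fun l (i : Fin (m + 1)) => l (steps e i.val))
    (fun l (i : Fin (m + 1)) => l (steps e i.val)) (by fun_prop) (fun _ => rfl)
    (fun l hl => of_walk hl)
  exact hxz.trans ((RotJoined.of_parallel hz fun i => (hlz i).symm).trans
    (hj.trans (RotJoined.of_parallel hy fun i => (hly i).symm).symm))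

/-- Families with the same commutation pattern are joined. -/
theorem rotJoined (hx : x ∈ Cyc e fun _ => Set.univ) (hy : y ∈ Cyc e fun _ => Set.univ) :
    RotJoined (Cyc e fun _ => Set.univ) x y := by
  by_cases he : ∃ i, Free e i
  · obtain ⟨i₀, hi₀⟩ := he
    obtain ⟨x', hx', hxx'⟩ := exists_freeOne hx
    obtain ⟨y', hy', hyy'⟩ := exists_freeOne hy
    exact hxx'.trans (((rotJoined_of_free hi₀ hx' hy').mono subset_univ).trans hyy'.symm)
  · exact rotJoined_of_forall_not_free (not_exists.1 he) hx hy

end Cyc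
end CyclesJoined

section CycleExistence

open Quaternion

/-- Any commutation pattern along a path of length at least two is realized with prescribed
anticommuting ends. -/
lemma exists_path_of_anticommute {v : ℍ} (hv : v ≠ 0) (m : ℕ) : ∀ {u : ℍ}, u ≠ 0 →
    u * v = (-1 : ℝ) • (v * u) → ∀ e : ℕ → Bool, ∃ w : ℕ → ℍ, (∀ k, w k ≠ 0) ∧ w 0 = u ∧
      w (m + 2) = v ∧ ∀ k < m + 2,
        w k * w (k + 1) = (if e k then -1 else 1 : ℝ) • (w (k + 1) * w k) := by
  induction m with
  | zero =>
    intro u hu huv e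
    have huv' := mul_eq_neg_smul_symm huv
    obtain ⟨c, hc, h0, h1⟩ : ∃ c : ℍ, c ≠ 0 ∧
        u * c = (if e 0 then -1 else 1 : ℝ) • (c * u) ∧
        c * v = (if e 1 then -1 else 1 : ℝ) • (v * c) := by
      cases e 0 <;> cases e 1
      · exact ⟨1, one_ne_zero, by simp, by simp⟩
      · exact ⟨u, hu, by simp, by simpa using huv⟩
      · exact ⟨v, hv, by simpa using huv, by simp⟩
      · refine ⟨u * v, mul_ne_zero hu hv, ?_, ?_⟩
        · rw [mul_assoc u v u, huv', mul_smul_comm, smul_smul]; simp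
        · rw [← mul_assoc v u v, huv', smul_mul_assoc, smul_smul]; simp
    refine ⟨consTwo u c fun _ => v, fun k => ?_, rfl, rfl, fun k hk => ?_⟩
    · match k with
      | 0 => exact hu
      | 1 => exact hc
      | k + 2 => exact hv
    · match k, hk with
      | 0, _ => exact h0
      | 1, _ => exact h1
  | succ m ih =>
    intro u hu huv e
    have huv' := mul_eq_neg_smul_symm huv
    obtain ⟨c, hc, h0, hcv⟩ : ∃ c : ℍ, c ≠ 0 ∧
        u * c = (if e 0 then -1 else 1 : ℝ) • (c * u) ∧ c * v = (-1 : ℝ) • (v * c) := by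
      cases e 0
      · exact ⟨u, hu, by simp, huv⟩
      · refine ⟨u * v, mul_ne_zero hu hv, ?_, ?_⟩
        · rw [mul_assoc u v u, huv', mul_smul_comm, smul_smul]; simp
        · rw [← mul_assoc v u v, huv', smul_mul_assoc, smul_smul]; simp
    obtain ⟨w, hw, hw0, hwm, hrel⟩ := ih hc hcv fun k => e (k + 1)
    refine ⟨fun k => Nat.casesOn k u w, fun k => ?_, rfl, hwm, fun k hk => ?_⟩
    · cases k
      · exact hu
      · exact hw _
    · cases k with
      | zero =>
        show u * w 0 = _ • (w 0 * u)
        rw [hw0]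
        exact h0
      | succ k => exact hrel k (by omega)

lemma exists_anticommute :
    ∃ u v : ℍ, u ≠ 0 ∧ v ≠ 0 ∧ u * v = (-1 : ℝ) • (v * u) := by
  obtain ⟨u, hu0, hu1, hu2, hu3⟩ := exists_quaternion 0 1 0 0
  obtain ⟨v, hv0, hv1, hv2, hv3⟩ := exists_quaternion 0 0 1 0
  refine ⟨u, v, ?_, ?_, ?_⟩
  · rintro rfl
    simp at hu1
  · rintro rfl
    simp at hv2
  · ext <;> simp [hu0, hu1, hu2, hu3, hv0, hv1, hv2, hv3]

namespace Cyc

/-- Every commutation pattern is realized on a cycle with at least three vertices. -/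
theorem nonempty {m : ℕ} (e : Fin (m + 2 + 1) → Bool) : (Cyc e fun _ => Set.univ).Nonempty := by
  by_cases he : ∃ r, e r = true
  · obtain ⟨r, hr⟩ := he
    obtain ⟨u, v, hu, hv, huv⟩ := exists_anticommute
    obtain ⟨w, hw, hw0, hwm, hrel⟩ := exists_path_of_anticommute hv m hu huv
      fun k => e (r + 1 + Fin.ofNat (m + 2 + 1) k)
    refine ⟨fun i => w (i - (r + 1)).val, mk (fun i => hw _) (fun _ => Set.mem_univ _) fun i => ?_⟩
    rw [val_succ_sub]
    split_ifs with hi h h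
    · rw [hi, hwm, hw0]
      exact mul_eq_neg_smul_symm huv
    · have hir : i - (r + 1) + 1 = 0 := by
        apply Fin.ext
        rw [Fin.val_add_one, if_pos (Fin.ext hi), Fin.val_zero]
      have : i = r := by
        rw [← sub_eq_zero, ← hir]
        abel
      exact absurd (this ▸ hr) h
    all_goals
      have := hrel (i - (r + 1)).val (by omega)
      rw [ofNat_val, add_sub_cancel] at this
      simpa [h] using this
  · refine ⟨fun _ => 1, mk (fun _ => one_ne_zero) (fun _ => Set.mem_univ _) fun i => ?_⟩
    have : e i = false := by simpa using not_exists.1 he i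
    simp [this]

end Cyc
end CycleExistence

section RepresentationVariety

open SimpleGraph

variable {m : ℕ}

lemma mem_repVar_cycleGraph_iff {x : Fin (m + 2 + 1) → SO3} :
    x ∈ RepVar (cycleGraph (m + 3)) ↔ ∀ i, (x i).1 * (x (i + 1)).1 = (x (i + 1)).1 * (x i).1 := by
  constructor
  · exact fun h i => h i (i + 1) (cycleGraph_adj.2 (Or.inr (add_sub_cancel_left i 1)))
  · intro h v w hvw
    rcases cycleGraph_adj.1 hvw with h1 | h1
    · obtain rfl := sub_eq_iff_eq_add'.1 h1
      exact (h w).symm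
    · obtain rfl := sub_eq_iff_eq_add'.1 h1
      exact h v

/-- The edges of the cycle along which the lifts of `x` to quaternions anticommute. -/
def pattern (x : RepVar (cycleGraph (m + 3))) (i : Fin (m + 2 + 1)) : Bool :=
  decide (traceSum (x.1 i).1 (x.1 (i + 1)).1 < -2)

lemma exists_lift (x : RepVar (cycleGraph (m + 3))) :
    ∃ q ∈ Cyc (pattern x) fun _ => Set.univ, ∀ i, rot (q i) = (x.1 i).1 := by
  choose q hq hqx using fun i => exists_rot_eq (x.1 i).2.1 (x.1 i).2.2
  refine ⟨q, Cyc.mk hq (fun _ => Set.mem_univ _) fun i => ?_, hqx⟩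
  have h := mem_repVar_cycleGraph_iff.1 x.2 i
  rw [← hqx, ← hqx] at h
  rw [pattern, ← hqx, ← hqx]
  rcases mul_eq_or_of_commute_rot (hq i) (hq (i + 1)) h with h1 | h1
  · have := traceSum_of_commute (hq i) (hq (i + 1)) h1
    rw [decide_eq_false (by linarith)]
    simpa using h1
  · rw [traceSum_of_anticommute (hq i) (hq (i + 1)) h1]
    simpa [show (-3 : ℝ) < -2 by norm_num] using h1

lemma exists_of_mem_cyc {e : Fin (m + 2 + 1) → Bool} {q : Fin (m + 2 + 1) → Quaternion ℝ}
    (hq : q ∈ Cyc e fun _ => Set.univ) :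
    ∃ x : RepVar (cycleGraph (m + 3)), (∀ i, (x.1 i).1 = rot (q i)) ∧ pattern x = e := by
  refine ⟨⟨fun i => ⟨rot (q i), rot_mem (hq.1 i)⟩, mem_repVar_cycleGraph_iff.2 fun i => ?_⟩,
    fun _ => rfl, funext fun i => ?_⟩
  · show rot (q i) * rot (q (i + 1)) = rot (q (i + 1)) * rot (q i)
    rw [← rot_mul, ← rot_mul, Cyc.rel hq i, rot_smul (by split_ifs <;> norm_num)]
  · show decide (traceSum (rot (q i)) (rot (q (i + 1))) < -2) = e i
    cases hi : e i
    · have := traceSum_of_commute (hq.1 i) (hq.1 (i + 1)) (Cyc.commute hq hi)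
      exact decide_eq_false (by linarith)
    · rw [traceSum_of_anticommute (hq.1 i) (hq.1 (i + 1)) (Cyc.anticommute hq hi)]
      norm_num

lemma continuous_pattern :
    Continuous (pattern : RepVar (cycleGraph (m + 3)) → Fin (m + 2 + 1) → Bool) := by
  refine continuous_pi fun i => (continuous_bool_rng true).2 ?_
  have hc : Continuous fun x : RepVar (cycleGraph (m + 3)) =>
      traceSum (x.1 i).1 (x.1 (i + 1)).1 := by
    have h (j : Fin (m + 2 + 1)) :
        Continuous fun x : RepVar (cycleGraph (m + 3)) => (x.1 j).1 :=
      continuous_subtype_val.comp ((continuous_apply j).comp continuous_subtype_val)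
    exact (((h i).matrix_trace).add (h (i + 1)).matrix_trace).add
      ((h i).matrix_mul (h (i + 1))).matrix_trace
  have h1 : (fun x : RepVar (cycleGraph (m + 3)) => pattern x i) ⁻¹' {true} =
      {x | traceSum (x.1 i).1 (x.1 (i + 1)).1 < -2} := by
    ext x
    simp [pattern]
  have h2 : {x : RepVar (cycleGraph (m + 3)) | traceSum (x.1 i).1 (x.1 (i + 1)).1 < -2} =
      {x | traceSum (x.1 i).1 (x.1 (i + 1)).1 ≤ -3} := by
    ext x
    obtain ⟨q, hq, hqx⟩ := exists_lift x
    simp only [Set.mem_ofPred_eq, ← hqx]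
    refine ⟨fun h => ?_, fun h => by linarith⟩
    cases hi : pattern x i
    · have := traceSum_of_commute (hq.1 i) (hq.1 (i + 1)) (Cyc.commute hq hi)
      linarith
    · exact (traceSum_of_anticommute (hq.1 i) (hq.1 (i + 1)) (Cyc.anticommute hq hi)).le
  rw [h1]
  exact ⟨h2 ▸ isClosed_le hc continuous_const, isOpen_lt hc continuous_const⟩

lemma joined_of_pattern_eq {x y : RepVar (cycleGraph (m + 3))} (h : pattern x = pattern y) :
    Joined x y := by
  obtain ⟨q, hq, hqx⟩ := exists_lift x
  obtain ⟨r, hr, hry⟩ := exists_lift y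
  rw [← h] at hr
  have key (A : rotMap '' Cyc (pattern x) fun _ => Set.univ) :
      ∃ z : RepVar (cycleGraph (m + 3)), ∀ i, (z.1 i).1 = A.1 i := by
    obtain ⟨_, p, hp, rfl⟩ := A
    obtain ⟨z, hz, -⟩ := exists_of_mem_cyc hp
    exact ⟨z, hz⟩
  choose f hf using key
  have hfz {p : Fin (m + 2 + 1) → Quaternion ℝ} {z : RepVar (cycleGraph (m + 3))}
      (hp : rotMap p ∈ rotMap '' Cyc (pattern x) fun _ => Set.univ)
      (hz : ∀ i, rot (p i) = (z.1 i).1) : f ⟨rotMap p, hp⟩ = z :=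
    Subtype.ext (funext fun i => Subtype.ext ((hf ⟨rotMap p, hp⟩ i).trans (hz i)))
  have hfc : Continuous f := by
    refine Continuous.subtype_mk (f := fun A => (f A).1) (continuous_pi fun i => ?_) _
    refine Continuous.subtype_mk (f := fun A => ((f A).1 i).1) ?_ _
    simp only [hf]
    exact (continuous_apply i).comp continuous_subtype_val
  have hj := (Cyc.rotJoined hq hr).joined_subtype.map hfc
  rwa [hfz _ hqx, hfz _ hry] at hj

end RepresentationVariety

theorem card_connectedComponents_repVar_cycle
    (n : ℕ) (hn : 3 ≤ n) :
    Nat.card (ConnectedComponents (RepVar (SimpleGraph.cycleGraph n))) = 2 ^ n := by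
  obtain ⟨m, rfl⟩ := Nat.exists_eq_add_of_le' hn
  have hbij : Function.Bijective (continuous_pattern (m := m)).connectedComponentsLift := by
    constructor
    · intro a b hab
      obtain ⟨x, rfl⟩ := ConnectedComponents.surjective_coe a
      obtain ⟨y, rfl⟩ := ConnectedComponents.surjective_coe b
      rw [Continuous.connectedComponentsLift_apply_coe,
        Continuous.connectedComponentsLift_apply_coe] at hab
      exact ConnectedComponents.coe_eq_coe'.2
        (pathComponent_subset_component y (joined_of_pattern_eq hab.symm))
    · intro e
      obtain ⟨q, hq⟩ := Cyc.nonempty e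
      obtain ⟨x, -, hx⟩ := exists_of_mem_cyc hq
      exact ⟨ConnectedComponents.mk x, hx⟩
  rw [Nat.card_eq_of_bijective _ hbij]
  simp

end
end
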